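/- arXiv:1602.06586 — 3 statements merged into one kernel-verified Lean document; each statement's English description precedes it below -/
import Mathlib

section
/- There exists a constant c > 0 such that for all sufficiently large M the following holds. Consider length-⌊cM⌋ observation sequences over the alphabet {1,...,M}. Let P′ be the law of ⌊cM⌋ i.i.d. draws from Uniform{1,...,M} (which is the output law of the 2-state HMM with p = q = Uniform{1,...,M}). Let P be the mixture, over a uniformly random subset S ⊂ {1,...,M} of size M/2, of the output laws of the 2-state HMM with symmetric transition matrix having off-diagonal entries 1/4, uniform initial state, emission distribution Uniform(S) in one state and Uniform(Sᶜ) in the other (so ‖p − q‖₁ = 1 for every such HMM). Then the total variation distance between P and P′ is less than 1/3; consequently every test (every measurable function from {1,...,M}^{⌊cM⌋} to {uniform, HMM}) has worst-case success probability at most 2/3 at distinguishing p = q = Uniform{1,...,M} from the case ‖p − q‖₁ = 1. -/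
open Finset
open scoped Classical BigOperators

noncomputable section

/-- Probability that a 2-state HMM with transition matrix `T` and emission densities `e`
emits the list `l`, starting from hidden state `s` (emit from the current state, then
transition). -/
def hmmCond {M : ℕ} (T : Bool → Bool → ℝ) (e : Bool → Fin M → ℝ) :
    Bool → List (Fin M) → ℝ
  | _, [] => 1
  | s, x :: xs => e s x * ∑ s' : Bool, T s s' * hmmCond T e s' xs

/-- Output law of a 2-state HMM with transition matrix `T`, initial state distribution `π₀`
and emission densities `e`, evaluated on the observation list `l`. -/
def hmmLaw {M : ℕ} (T : Bool → Bool → ℝ) (π₀ : Bool → ℝ) (e : Bool → Fin M → ℝ)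
    (l : List (Fin M)) : ℝ :=
  ∑ s : Bool, π₀ s * hmmCond T e s l

/-- The symmetric 2-state transition matrix with switching probability 1/4. -/
def Tq : Bool → Bool → ℝ := fun s s' => if s = s' then 3 / 4 else 1 / 4

/-- Emission densities: uniform on `S` in state `true`, uniform on `Sᶜ` in state `false`
(where `|S| = M/2`). -/
def emitHalf (M : ℕ) (S : Finset (Fin M)) : Bool → Fin M → ℝ := fun b i =>
  if (i ∈ S ↔ b = true) then 2 / (M : ℝ) else 0

/-- The mixture, over a uniformly random subset `S ⊆ {1,…,M}` with `|S| = M/2`, of the output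
laws of the corresponding 2-state HMMs (uniform initial state). -/
def Pmix (M k : ℕ) (G : Fin k → Fin M) : ℝ :=
  (∑ S ∈ (Finset.univ : Finset (Fin M)).powersetCard (M / 2),
      hmmLaw Tq (fun _ => 1 / 2) (emitHalf M S) (List.ofFn G)) /
    (((Finset.univ : Finset (Fin M)).powersetCard (M / 2)).card : ℝ)

/-- The law of `k` i.i.d. uniform draws from `{1,…,M}`. -/
def Punif (M k : ℕ) (_G : Fin k → Fin M) : ℝ := (1 / (M : ℝ)) ^ k

/-- The sign attached to a hidden state. -/
def boolSign (b : Bool) : ℝ := if b then 1 else -1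

/-- The `±1`-valued indicator of a set. -/
def indSign {M : ℕ} (S : Finset (Fin M)) (x : Fin M) : ℝ := if x ∈ S then 1 else -1

/-- The correlation of the `±1`-valued indicators of two sets. -/
def corr {M : ℕ} (S T : Finset (Fin M)) : ℝ := ∑ x, indSign S x * indSign T x

theorem sum_ofFn_succ {α : Type*} [Fintype α] (k : ℕ) (F : List α → ℝ) :
    ∑ G : Fin (k + 1) → α, F (List.ofFn G) =
      ∑ x, ∑ G : Fin k → α, F (x :: List.ofFn G) := by
  rw [← (Fin.consEquiv fun _ => α).sum_comp, Fintype.sum_prod_type]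
  simp [Fin.consEquiv, List.ofFn_succ]

theorem emitHalf_eq (M : ℕ) (S : Finset (Fin M)) (b : Bool) (x : Fin M) :
    emitHalf M S b x = (1 + boolSign b * indSign S x) / M := by
  unfold emitHalf boolSign indSign
  by_cases h : x ∈ S <;> cases b <;> simp [h] <;> norm_num

theorem sum_indSign {M : ℕ} (hM : Even M) {S : Finset (Fin M)} (hS : S.card = M / 2) :
    ∑ x, indSign S x = 0 := by
  obtain ⟨n, rfl⟩ := hM
  have h : ∀ x, indSign S x = 2 * (if x ∈ S then 1 else 0) - 1 := fun x => by
    unfold indSign; split_ifs <;> norm_num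
  have hn : (n + n) / 2 = n := by omega
  simp only [h, Finset.sum_sub_distrib, ← Finset.mul_sum]
  simp [hS, hn]
  ring

theorem sum_emitHalf {M : ℕ} (h0 : 0 < M) (hM : Even M) {S : Finset (Fin M)}
    (hS : S.card = M / 2) (s : Bool) : ∑ x, emitHalf M S s x = 1 := by
  have h0' : (M : ℝ) ≠ 0 := by positivity
  simp only [emitHalf_eq, ← Finset.sum_div, Finset.sum_add_distrib, ← Finset.mul_sum,
    sum_indSign hM hS]
  simp [h0']

theorem sum_emitHalf_mul {M : ℕ} (h0 : 0 < M) (hM : Even M) {S T : Finset (Fin M)}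
    (hS : S.card = M / 2) (hT : T.card = M / 2) (s t : Bool) :
    ∑ x, emitHalf M S s x * emitHalf M T t x =
      (1 + boolSign s * boolSign t * (corr S T / M)) / M := by
  have h0' : (M : ℝ) ≠ 0 := by positivity
  have h : ∀ x, emitHalf M S s x * emitHalf M T t x =
      (1 + boolSign s * indSign S x + boolSign t * indSign T x +
        boolSign s * boolSign t * (indSign S x * indSign T x)) / M ^ 2 := fun x => by
    rw [emitHalf_eq, emitHalf_eq]; field_simp; ring
  simp only [h, ← Finset.sum_div, Finset.sum_add_distrib, ← Finset.mul_sum,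
    sum_indSign hM hS, sum_indSign hM hT]
  rw [← corr]
  simp
  field_simp

theorem sum_hmmCond {M : ℕ} (h0 : 0 < M) (hM : Even M) {S : Finset (Fin M)}
    (hS : S.card = M / 2) (k : ℕ) (s : Bool) :
    ∑ G : Fin k → Fin M, hmmCond Tq (emitHalf M S) s (List.ofFn G) = 1 := by
  induction k generalizing s with
  | zero => simp [hmmCond]
  | succ k ih =>
    rw [sum_ofFn_succ]
    simp only [hmmCond, ← Finset.mul_sum]
    rw [← Finset.sum_mul, sum_emitHalf h0 hM hS, Finset.sum_comm]
    simp only [← Finset.mul_sum, ih]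
    cases s <;> norm_num [Tq]

theorem sum_hmmLaw {M : ℕ} (h0 : 0 < M) (hM : Even M) {S : Finset (Fin M)}
    (hS : S.card = M / 2) (k : ℕ) :
    ∑ G : Fin k → Fin M, hmmLaw Tq (fun _ => 1 / 2) (emitHalf M S) (List.ofFn G) = 1 := by
  simp only [hmmLaw]
  rw [Finset.sum_comm]
  simp only [← Finset.mul_sum, sum_hmmCond h0 hM hS]
  norm_num

/-- One step of the coupled pair of hidden chains. -/
theorem sum_hmmCond_mul_succ {M : ℕ} (h0 : 0 < M) (hM : Even M) {S T : Finset (Fin M)}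
    (hS : S.card = M / 2) (hT : T.card = M / 2) (k : ℕ) (s t : Bool) :
    ∑ G : Fin (k + 1) → Fin M, hmmCond Tq (emitHalf M S) s (List.ofFn G) *
        hmmCond Tq (emitHalf M T) t (List.ofFn G) =
      (1 + boolSign s * boolSign t * (corr S T / M)) / M *
        ∑ s', ∑ t', Tq s s' * Tq t t' *
          ∑ G : Fin k → Fin M, hmmCond Tq (emitHalf M S) s' (List.ofFn G) *
            hmmCond Tq (emitHalf M T) t' (List.ofFn G) := by
  rw [← sum_emitHalf_mul h0 hM hS hT,
    sum_ofFn_succ k fun l => hmmCond Tq (emitHalf M S) s l * hmmCond Tq (emitHalf M T) t l,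
    Finset.sum_mul]
  refine Finset.sum_congr rfl fun x _ => ?_
  simp only [hmmCond, Fintype.sum_bool, Finset.mul_sum, ← Finset.sum_add_distrib]
  exact Finset.sum_congr rfl fun G _ => by ring

theorem sum_hmmCond_mul {M : ℕ} (h0 : 0 < M) (hM : Even M) {S T : Finset (Fin M)}
    (hS : S.card = M / 2) (hT : T.card = M / 2) (k : ℕ) :
    ∃ a b : ℝ, (∀ s t, ∑ G : Fin k → Fin M, hmmCond Tq (emitHalf M S) s (List.ofFn G) *
        hmmCond Tq (emitHalf M T) t (List.ofFn G) =
          (a + boolSign s * boolSign t * b) / M ^ k) ∧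
      |a| ≤ (1 + (corr S T / M) ^ 2 / 2) ^ k ∧
      |b| ≤ 2 * |corr S T / M| * (1 + (corr S T / M) ^ 2 / 2) ^ k := by
  have h0' : (M : ℝ) ≠ 0 := by positivity
  obtain ⟨r, hr⟩ : ∃ r, r = corr S T / M := ⟨_, rfl⟩
  rw [← hr]
  induction k with
  | zero => exact ⟨1, 0, by simp [hmmCond]⟩
  | succ k ih =>
    obtain ⟨a, b, h, ha, hb⟩ := ih
    have hA : |a + r * (b / 4)| ≤ (1 + r ^ 2 / 2) ^ (k + 1) :=
      calc |a + r * (b / 4)| ≤ |a| + |r| * (|b| / 4) := by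
            refine (abs_add_le _ _).trans_eq ?_
            rw [abs_mul, abs_div, abs_of_pos (by norm_num : (0 : ℝ) < 4)]
        _ ≤ (1 + r ^ 2 / 2) ^ k + |r| * (2 * |r| * (1 + r ^ 2 / 2) ^ k / 4) := by gcongr
        _ = (1 + r ^ 2 / 2) ^ (k + 1) := by rw [← sq_abs r]; ring
    refine ⟨a + r * (b / 4), r * a + b / 4, fun s t => ?_, hA, ?_⟩
    · rw [sum_hmmCond_mul_succ h0 hM hS hT, ← hr]
      simp only [h]
      cases s <;> cases t <;> simp [boolSign, Tq] <;> field_simp <;> ring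
    · calc |r * a + b / 4| ≤ |r| * |a| + |b| / 4 := by
            refine (abs_add_le _ _).trans_eq ?_
            rw [abs_mul, abs_div, abs_of_pos (by norm_num : (0 : ℝ) < 4)]
        _ ≤ |r| * (1 + r ^ 2 / 2) ^ k + 2 * |r| * (1 + r ^ 2 / 2) ^ k / 4 := by gcongr
        _ ≤ 2 * |r| * (1 + r ^ 2 / 2) ^ (k + 1) := by
            rw [pow_succ]
            have : 0 ≤ |r| * (1 + r ^ 2 / 2) ^ k := by positivity
            calc _ = 3 / 2 * (|r| * (1 + r ^ 2 / 2) ^ k) := by ring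
              _ ≤ 2 * (|r| * (1 + r ^ 2 / 2) ^ k) * (1 + r ^ 2 / 2) := by
                nlinarith [mul_nonneg this (sq_nonneg r)]
              _ = _ := by ring

theorem sum_hmmLaw_mul_le {M : ℕ} (h0 : 0 < M) (hM : Even M) {S T : Finset (Fin M)}
    (hS : S.card = M / 2) (hT : T.card = M / 2) (k : ℕ) :
    ∑ G : Fin k → Fin M, hmmLaw Tq (fun _ => 1 / 2) (emitHalf M S) (List.ofFn G) *
        hmmLaw Tq (fun _ => 1 / 2) (emitHalf M T) (List.ofFn G) ≤
      (1 + (corr S T / M) ^ 2 / 2) ^ k / M ^ k := by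
  obtain ⟨a, b, h, ha, -⟩ := sum_hmmCond_mul h0 hM hS hT k
  calc _ = ∑ s, ∑ t, 1 / 4 * ∑ G : Fin k → Fin M,
        hmmCond Tq (emitHalf M S) s (List.ofFn G) *
          hmmCond Tq (emitHalf M T) t (List.ofFn G) := by
        simp only [hmmLaw, Fintype.sum_bool, Finset.mul_sum, ← Finset.sum_add_distrib]
        exact Finset.sum_congr rfl fun G _ => by ring
    _ = a / M ^ k := by
        simp only [h, Fintype.sum_bool, boolSign]
        norm_num
        ring
    _ ≤ _ := by gcongr; exact (le_abs_self a).trans ha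

open Polynomial in
theorem coeff_pow_le_coeff_pow {P Q : ℝ[X]} (hP : ∀ i, 0 ≤ P.coeff i)
    (hPQ : ∀ i, P.coeff i ≤ Q.coeff i) (n i : ℕ) :
    0 ≤ (P ^ n).coeff i ∧ (P ^ n).coeff i ≤ (Q ^ n).coeff i := by
  induction n generalizing i with
  | zero => simp [Polynomial.coeff_one]; split_ifs <;> norm_num
  | succ n ih =>
    simp only [pow_succ, Polynomial.coeff_mul]
    exact ⟨Finset.sum_nonneg fun x _ => mul_nonneg (ih _).1 (hP _),
      Finset.sum_le_sum fun x _ => mul_le_mul (ih _).2 (hPQ _) (hP _) ((ih _).1.trans (ih _).2)⟩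

theorem corr_eq {M : ℕ} (hM : Even M) {S T : Finset (Fin M)} (hT : T.card = M / 2) :
    corr S T = ∑ x ∈ S, 2 * indSign T x := by
  have h : ∀ x, indSign S x * indSign T x =
      (if x ∈ S then 2 * indSign T x else 0) - indSign T x := fun x => by
    unfold indSign; split_ifs <;> norm_num
  simp only [corr, h, Finset.sum_sub_distrib, sum_indSign hM hT]
  simp

open Polynomial in
theorem prod_X_add_C_exp_indSign {n : ℕ} {T : Finset (Fin (n + n))} (hT : T.card = n) (u : ℝ) :
    ∏ x, ((X : ℝ[X]) + C (Real.exp (u * indSign T x))) =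
      (X ^ 2 + C (2 * Real.cosh u) * X + 1) ^ n := by
  have hTc : Tᶜ.card = n := by rw [Finset.card_compl, hT]; simp
  have h1 : ∀ x ∈ T, (X : ℝ[X]) + C (Real.exp (u * indSign T x)) = X + C (Real.exp u) :=
    fun x hx => by simp [indSign, hx]
  have h2 : ∀ x ∈ Tᶜ, (X : ℝ[X]) + C (Real.exp (u * indSign T x)) = X + C (Real.exp (-u)) :=
    fun x hx => by simp [indSign, Finset.mem_compl.1 hx]
  rw [← Finset.prod_mul_prod_compl T, Finset.prod_congr rfl h1, Finset.prod_congr rfl h2,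
    Finset.prod_const, Finset.prod_const, hT, hTc, ← mul_pow]
  congr 1
  have h3 : Real.exp u * Real.exp (-u) = 1 := by rw [← Real.exp_add]; simp
  have h4 : (C (Real.exp u) * C (Real.exp (-u)) : ℝ[X]) = 1 := by rw [← C_mul, h3, C_1]
  have h5 : (2 : ℝ) * Real.cosh u = Real.exp u + Real.exp (-u) := by rw [Real.cosh_eq]; ring
  rw [h5, C_add]
  linear_combination h4

open Polynomial in
theorem sum_exp_corr_le {n : ℕ} {T : Finset (Fin (n + n))} (hT : T.card = n) (θ : ℝ) :
    ∑ S ∈ (Finset.univ : Finset (Fin (n + n))).powersetCard n, Real.exp (θ * corr S T) ≤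
      ((n + n).choose n : ℝ) * Real.exp (θ ^ 2 * (n + n : ℕ)) := by
  have hT' : T.card = (n + n) / 2 := by omega
  have h1 : ∑ S ∈ (Finset.univ : Finset (Fin (n + n))).powersetCard n, Real.exp (θ * corr S T) =
      (((X : ℝ[X]) ^ 2 + C (2 * Real.cosh (2 * θ)) * X + 1) ^ n).coeff n := by
    rw [← prod_X_add_C_exp_indSign hT,
      Finset.prod_X_add_C_coeff _ _ (by simp), Finset.card_fin, Nat.add_sub_cancel]
    refine Finset.sum_congr rfl fun S _ => ?_
    rw [corr_eq ⟨n, rfl⟩ hT', ← Real.exp_sum, Finset.mul_sum]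
    exact congrArg _ (Finset.sum_congr rfl fun x _ => by ring)
  have hc : 1 ≤ Real.cosh (2 * θ) := Real.one_le_cosh _
  have hsq : (C (Real.cosh (2 * θ)) * (1 + X) ^ 2 : ℝ[X]) = C (Real.cosh (2 * θ)) * X ^ 2 +
      C (2 * Real.cosh (2 * θ)) * X + C (Real.cosh (2 * θ)) * 1 := by
    rw [C_mul, show (C 2 : ℝ[X]) = 2 from rfl]; ring
  have h2 := (coeff_pow_le_coeff_pow (P := (X : ℝ[X]) ^ 2 + C (2 * Real.cosh (2 * θ)) * X + 1)
    (Q := C (Real.cosh (2 * θ)) * (1 + X) ^ 2) (fun i => ?_) (fun i => ?_) n n).2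
  · rw [h1]
    refine h2.trans ?_
    rw [mul_pow, ← C_pow, coeff_C_mul, ← pow_mul, coeff_one_add_X_pow, mul_comm, two_mul]
    gcongr
    calc Real.cosh (2 * θ) ^ n ≤ Real.exp ((2 * θ) ^ 2 / 2) ^ n := by
          gcongr; exact Real.cosh_le_exp_half_sq _
      _ = Real.exp (θ ^ 2 * (n + n : ℕ)) := by
          rw [← Real.exp_nat_mul]; congr 1; push_cast; ring
  · simp only [coeff_add, coeff_C_mul, coeff_X_pow, coeff_X, coeff_one]
    split_ifs <;> linarith
  · rw [hsq]
    simp only [coeff_add, coeff_C_mul, coeff_X_pow, coeff_X, coeff_one]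
    split_ifs <;> linarith

theorem pow_two_mul_le_factorial_mul_exp (y : ℝ) (m : ℕ) :
    y ^ (2 * m) ≤ (2 * m).factorial * (Real.exp y + Real.exp (-y)) := by
  have h1 := Real.pow_div_factorial_le_exp |y| (abs_nonneg y) (2 * m)
  rw [div_le_iff₀ (by positivity), pow_mul, sq_abs, ← pow_mul] at h1
  have h2 : Real.exp |y| ≤ Real.exp y + Real.exp (-y) := by
    rcases abs_cases y with ⟨h, -⟩ | ⟨h, -⟩ <;> rw [h] <;>
      linarith [Real.exp_pos y, Real.exp_pos (-y)]
  calc y ^ (2 * m) ≤ Real.exp |y| * (2 * m).factorial := h1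
    _ ≤ _ := by rw [mul_comm]; gcongr

theorem sum_corr_pow_le {n : ℕ} (hn : 0 < n) {T : Finset (Fin (n + n))} (hT : T.card = n)
    (m : ℕ) :
    (m : ℝ) ^ m * ∑ S ∈ (Finset.univ : Finset (Fin (n + n))).powersetCard n,
        (corr S T / (n + n : ℕ)) ^ (2 * m) ≤
      ((n + n).choose n : ℝ) * (2 * (2 * m).factorial * Real.exp 1 ^ m / (n + n : ℕ) ^ m) := by
  obtain ⟨M, hM⟩ : ∃ M : ℝ, M = ((n + n : ℕ) : ℝ) := ⟨_, rfl⟩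
  have hM0 : 0 < M := by rw [hM]; positivity
  obtain ⟨θ, hθ⟩ : ∃ θ : ℝ, θ ^ 2 = m / M := ⟨√(m / M), Real.sq_sqrt (by positivity)⟩
  have hexp : Real.exp (θ ^ 2 * M) = Real.exp 1 ^ m := by
    rw [hθ, div_mul_cancel₀ _ hM0.ne', ← Real.exp_nat_mul, mul_one]
  have h1 := sum_exp_corr_le hT θ
  have h2 := sum_exp_corr_le hT (-θ)
  rw [neg_sq] at h2
  rw [← hM, hexp] at h1 h2
  rw [← hM]
  calc _ = (∑ S ∈ (Finset.univ : Finset (Fin (n + n))).powersetCard n,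
        (θ * corr S T) ^ (2 * m)) / M ^ m := by
        rw [Finset.mul_sum, Finset.sum_div]
        refine Finset.sum_congr rfl fun S _ => ?_
        rw [mul_pow, pow_mul θ, hθ, div_pow, div_pow, two_mul m, pow_add M]
        field_simp
    _ ≤ (∑ S ∈ (Finset.univ : Finset (Fin (n + n))).powersetCard n, (2 * m).factorial *
        (Real.exp (θ * corr S T) + Real.exp (-θ * corr S T))) / M ^ m := by
        gcongr with S
        rw [neg_mul]
        exact pow_two_mul_le_factorial_mul_exp _ _
    _ ≤ (2 * m).factorial * (((n + n).choose n : ℝ) * Real.exp 1 ^ m +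
          ((n + n).choose n : ℝ) * Real.exp 1 ^ m) / M ^ m := by
        rw [← Finset.mul_sum, Finset.sum_add_distrib]
        gcongr
    _ = _ := by ring

theorem choose_mul_factorial_two_mul_le (k m : ℕ) :
    k.choose m * (2 * m).factorial ≤ k ^ m * (2 * m) ^ m := by
  have h : (2 * m - m).factorial * (2 * m).descFactorial m = (2 * m).factorial :=
    Nat.factorial_mul_descFactorial (by omega)
  rw [show 2 * m - m = m by omega] at h
  rw [← h, ← mul_assoc, mul_comm (k.choose m), ← Nat.descFactorial_eq_factorial_mul_choose]
  exact Nat.mul_le_mul (Nat.descFactorial_le_pow _ _) (Nat.descFactorial_le_pow _ _)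

theorem sum_choose_mul_corr_pow_le {n k : ℕ} (hn : 0 < n) (hk : (k : ℝ) ≤ 1 / 24 * (n + n : ℕ))
    {T : Finset (Fin (n + n))} (hT : T.card = n) {m : ℕ} (hm : 0 < m) :
    ∑ S ∈ (Finset.univ : Finset (Fin (n + n))).powersetCard n,
        ((corr S T / (n + n : ℕ)) ^ 2 / 2) ^ m * (k.choose m : ℝ) ≤
      ((n + n).choose n : ℝ) * (2 * (1 / 8) ^ m) := by
  have h1 := sum_corr_pow_le hn hT m
  have h2 : (k.choose m : ℝ) * (2 * m).factorial ≤ (k : ℝ) ^ m * (2 * m) ^ m := by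
    exact_mod_cast choose_mul_factorial_two_mul_le k m
  obtain ⟨M, hM⟩ : ∃ M : ℝ, M = ((n + n : ℕ) : ℝ) := ⟨_, rfl⟩
  have hM0 : 0 < M := by rw [hM]; positivity
  have hm0 : (0 : ℝ) < (m : ℝ) ^ m := by positivity
  rw [← hM] at h1 hk ⊢
  have h3 : Real.exp 1 * k / M ≤ 1 / 8 := by
    rw [div_le_iff₀ hM0]
    nlinarith [Real.exp_one_lt_d9, Real.exp_pos 1]
  rw [mul_comm, ← le_div_iff₀ hm0] at h1
  calc _ = (k.choose m : ℝ) / 2 ^ m *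
        ∑ S ∈ (Finset.univ : Finset (Fin (n + n))).powersetCard n, (corr S T / M) ^ (2 * m) := by
        rw [Finset.mul_sum]
        exact Finset.sum_congr rfl fun S _ => by rw [div_pow _ _ m, ← pow_mul]; ring
    _ ≤ (k.choose m : ℝ) / 2 ^ m * (((n + n).choose n : ℝ) *
        (2 * (2 * m).factorial * Real.exp 1 ^ m / M ^ m) / (m : ℝ) ^ m) := by gcongr
    _ = ((n + n).choose n : ℝ) * (2 * ((k.choose m * (2 * m).factorial) *
        (Real.exp 1 ^ m / M ^ m / (m : ℝ) ^ m / 2 ^ m))) := by ring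
    _ ≤ ((n + n).choose n : ℝ) * (2 * (((k : ℝ) ^ m * (2 * m) ^ m) *
        (Real.exp 1 ^ m / M ^ m / (m : ℝ) ^ m / 2 ^ m))) := by gcongr
    _ = ((n + n).choose n : ℝ) * (2 * (Real.exp 1 * k / M) ^ m) := by
        rw [div_pow, mul_pow, mul_pow]; field_simp
    _ ≤ _ := by gcongr

theorem sum_one_add_corr_pow_le {n k : ℕ} (hn : 0 < n) (hk : (k : ℝ) ≤ 1 / 24 * (n + n : ℕ))
    {T : Finset (Fin (n + n))} (hT : T.card = n) :
    ∑ S ∈ (Finset.univ : Finset (Fin (n + n))).powersetCard n,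
        (1 + (corr S T / (n + n : ℕ)) ^ 2 / 2) ^ k ≤
      ((n + n).choose n : ℝ) * (9 / 7) := by
  have hgeom : ∀ k : ℕ, ∑ i ∈ Finset.range k, (2 : ℝ) * (1 / 8) ^ (i + 1) =
      2 / 7 * (1 - (1 / 8) ^ k) := fun k => by
    induction k with
    | zero => simp
    | succ k ih => rw [Finset.sum_range_succ, ih]; ring
  simp only [add_comm (1 : ℝ), add_pow, one_pow, mul_one]
  rw [Finset.sum_comm, Finset.sum_range_succ']
  calc _ ≤ ∑ i ∈ Finset.range k, ((n + n).choose n : ℝ) * (2 * (1 / 8) ^ (i + 1)) +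
        ((n + n).choose n : ℝ) := by
        refine add_le_add (Finset.sum_le_sum fun i _ =>
          sum_choose_mul_corr_pow_le hn hk hT i.succ_pos) ?_
        simp
    _ ≤ _ := by
        rw [← Finset.mul_sum, hgeom]
        have : (0 : ℝ) ≤ ((n + n).choose n : ℝ) * (1 / 8) ^ k := by positivity
        nlinarith

theorem sum_Pmix {M : ℕ} (h0 : 0 < M) (hM : Even M) (k : ℕ) :
    ∑ G : Fin k → Fin M, Pmix M k G = 1 := by
  have hN : (((Finset.univ : Finset (Fin M)).powersetCard (M / 2)).card : ℝ) ≠ 0 := by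
    rw [Finset.card_powersetCard, Finset.card_fin]
    exact_mod_cast (Nat.choose_pos (Nat.div_le_self M 2)).ne'
  simp only [Pmix, ← Finset.sum_div]
  rw [Finset.sum_comm, Finset.sum_congr rfl fun S hS =>
    sum_hmmLaw h0 hM (Finset.mem_powersetCard.1 hS).2 k]
  simp only [Finset.sum_const, nsmul_eq_mul, mul_one]
  exact div_self hN

theorem sum_Punif {M : ℕ} (h0 : 0 < M) (k : ℕ) : ∑ G : Fin k → Fin M, Punif M k G = 1 := by
  have h0' : (M : ℝ) ≠ 0 := by positivity
  simp [Punif, h0']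

theorem sum_Pmix_sq_le {M k : ℕ} (h0 : 0 < M) (hM : Even M) (hk : (k : ℝ) ≤ 1 / 24 * M) :
    ∑ G : Fin k → Fin M, Pmix M k G ^ 2 ≤ 9 / 7 / (M : ℝ) ^ k := by
  obtain ⟨n, rfl⟩ := hM
  have hn : 0 < n := by omega
  have hn2 : (n + n) / 2 = n := by omega
  have hN : (0 : ℝ) < ((n + n).choose n : ℝ) := by
    exact_mod_cast Nat.choose_pos (Nat.le_add_right n n)
  simp only [Pmix, div_pow, ← Finset.sum_div, hn2, Finset.card_powersetCard, Finset.card_fin]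
  rw [div_le_iff₀ (by positivity)]
  simp only [sq (∑ S ∈ _, _), Finset.sum_mul_sum]
  rw [Finset.sum_comm]
  calc _ = ∑ T ∈ (Finset.univ : Finset (Fin (n + n))).powersetCard n,
        ∑ S ∈ (Finset.univ : Finset (Fin (n + n))).powersetCard n,
          ∑ G : Fin k → Fin (n + n),
            hmmLaw Tq (fun _ => 1 / 2) (emitHalf (n + n) S) (List.ofFn G) *
              hmmLaw Tq (fun _ => 1 / 2) (emitHalf (n + n) T) (List.ofFn G) := by
        refine Finset.sum_congr rfl fun T _ => ?_
        rw [Finset.sum_comm]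
        simp only [mul_comm]
    _ ≤ ∑ T ∈ (Finset.univ : Finset (Fin (n + n))).powersetCard n,
        ∑ S ∈ (Finset.univ : Finset (Fin (n + n))).powersetCard n,
          (1 + (corr S T / (n + n : ℕ)) ^ 2 / 2) ^ k / ((n + n : ℕ) : ℝ) ^ k := by
        refine Finset.sum_le_sum fun T hT => Finset.sum_le_sum fun S hS => ?_
        exact sum_hmmLaw_mul_le h0 ⟨n, rfl⟩ ((Finset.mem_powersetCard.1 hS).2.trans hn2.symm)
          ((Finset.mem_powersetCard.1 hT).2.trans hn2.symm) k
    _ ≤ ∑ T ∈ (Finset.univ : Finset (Fin (n + n))).powersetCard n,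
        ((n + n).choose n : ℝ) * (9 / 7) / ((n + n : ℕ) : ℝ) ^ k := by
        refine Finset.sum_le_sum fun T hT => ?_
        rw [← Finset.sum_div]
        gcongr
        exact sum_one_add_corr_pow_le hn hk (Finset.mem_powersetCard.1 hT).2
    _ = _ := by
        rw [Finset.sum_const, Finset.card_powersetCard, Finset.card_fin, nsmul_eq_mul]
        ring

theorem sum_abs_Pmix_sub_Punif_lt {M k : ℕ} (h0 : 0 < M) (hM : Even M)
    (hk : (k : ℝ) ≤ 1 / 24 * M) :
    1 / 2 * ∑ G : Fin k → Fin M, |Pmix M k G - Punif M k G| < 1 / 3 := by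
  have h0' : (0 : ℝ) < (M : ℝ) ^ k := by positivity
  have hcs := sq_sum_le_card_mul_sum_sq (s := (Finset.univ : Finset (Fin k → Fin M)))
    (f := fun G => |Pmix M k G - Punif M k G|)
  have hchi : (M : ℝ) ^ k * ∑ G : Fin k → Fin M, |Pmix M k G - Punif M k G| ^ 2 ≤ 2 / 7 := by
    have h : ∀ G : Fin k → Fin M, |Pmix M k G - Punif M k G| ^ 2 =
        Pmix M k G ^ 2 - 2 / (M : ℝ) ^ k * Pmix M k G + 1 / (M : ℝ) ^ k * Punif M k G :=
      fun G => by rw [sq_abs, Punif, one_div_pow]; ring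
    simp only [h, Finset.sum_add_distrib, Finset.sum_sub_distrib, ← Finset.mul_sum,
      sum_Pmix h0 hM, sum_Punif h0]
    have h2 := sum_Pmix_sq_le h0 hM hk
    rw [le_div_iff₀ h0'] at h2
    calc _ = (∑ G : Fin k → Fin M, Pmix M k G ^ 2) * (M : ℝ) ^ k - 1 := by field_simp; ring
      _ ≤ _ := by linarith
  simp only [Finset.card_univ, Fintype.card_fun, Fintype.card_fin, Nat.cast_pow] at hcs
  nlinarith

theorem min_sum_filter_le {α : Type*} [Fintype α] {P Q : α → ℝ} (hP : ∑ x, P x = 1)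
    (hQ : ∑ x, Q x = 1) (hPQ : 1 / 2 * ∑ x, |P x - Q x| < 1 / 3) (test : α → Bool) :
    min (∑ x ∈ Finset.univ.filter (fun x => test x = false), Q x)
      (∑ x ∈ Finset.univ.filter (fun x => test x = true), P x) ≤ 2 / 3 := by
  have hsplit : ∀ f : α → ℝ, ∑ x ∈ Finset.univ.filter (fun x => test x = true), f x +
      ∑ x ∈ Finset.univ.filter (fun x => test x = false), f x = ∑ x, f x := fun f => by
    simpa using Finset.sum_filter_add_sum_filter_not Finset.univ (fun x => test x = true) f
  have h1 := (le_abs_self _).trans (Finset.abs_sum_le_sum_abs (fun x => P x - Q x)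
    (Finset.univ.filter fun x => test x = true))
  have h2 := (neg_le_abs _).trans (Finset.abs_sum_le_sum_abs (fun x => P x - Q x)
    (Finset.univ.filter fun x => test x = false))
  rw [Finset.sum_sub_distrib] at h1 h2
  have h3 := hsplit fun x => |P x - Q x|
  have h4 := hsplit P
  have h5 := hsplit Q
  by_contra! h
  obtain ⟨h6, h7⟩ := lt_min_iff.1 h
  linarith

/-- there is a constant `c > 0` such that for all sufficiently large (even) `M`,
the total variation distance between the length-`⌊cM⌋` uniform i.i.d. law and the 2-state HMM
mixture law is less than `1/3`; consequently every test distinguishing the two has worst-case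
success probability at most `2/3`. -/
theorem stmt1 :
    ∃ c : ℝ, 0 < c ∧
      ∃ M₀ : ℕ, ∀ M : ℕ, M₀ ≤ M → Even M →
        (1 / 2) * (∑ G : Fin (Nat.floor (c * M)) → Fin M,
            |Pmix M (Nat.floor (c * M)) G - Punif M (Nat.floor (c * M)) G|) < 1 / 3 ∧
        ∀ test : (Fin (Nat.floor (c * M)) → Fin M) → Bool,
          min
            (∑ G ∈ Finset.univ.filter (fun G => test G = false),
              Punif M (Nat.floor (c * M)) G)
            (∑ G ∈ Finset.univ.filter (fun G => test G = true),
              Pmix M (Nat.floor (c * M)) G) ≤ 2 / 3 := by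
  have hk : ∀ M : ℕ, ((⌊(1 / 24 : ℝ) * M⌋₊ : ℕ) : ℝ) ≤ 1 / 24 * M := fun M =>
    Nat.floor_le (by positivity)
  refine ⟨1 / 24, by norm_num, 1, fun M h0 hM => ?_⟩
  have h := sum_abs_Pmix_sub_Punif_lt h0 hM (hk M)
  exact ⟨h, fun test => min_sum_filter_le (sum_Pmix h0 hM _) (sum_Punif h0 _) h test⟩
end
end

section
/- With probability 1 − o(1) as N → ∞, simultaneously for every bin index k with k ≥ k₀ = 4 log(c₀R/(ε√w_min)) + 16 and |I_k| ≥ 20 e^{−3(k+1)/2} N, the regularization step zeroes out fewer than 10·w_min/(32·ρ̄_k²·N) rows and columns of the k-th diagonal block. -/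
open Matrix MeasureTheory ProbabilityTheory Filter
open scoped Classical ENNReal BigOperators

noncomputable section

/-- The spectral (operator `ℓ²→ℓ²`) norm of a real matrix. -/
def specNorm {m n : ℕ} (A : Matrix (Fin m) (Fin n) ℝ) : ℝ :=
  ‖LinearMap.toContinuousLinearMap (Matrix.toEuclideanLin A)‖

/-- The law of the Poissonized count matrix: the entries `C (i,j)` are mutually independent
with `C (i,j) ~ Poisson(N · B i j)`. -/
def countMeasure (M N : ℕ) (B : Matrix (Fin M) (Fin M) ℝ) :
    Measure ((Fin M × Fin M) → ℕ) :=
  Measure.pi fun p => ProbabilityTheory.poissonMeasure ((N : ℝ) * B p.1 p.2).toNNReal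

/-- Empirical marginal probability `ρ̂_i = Σ_j (C_{i,j} + C_{j,i}) / (2N)`. -/
def empMarg (M N : ℕ) (C : (Fin M × Fin M) → ℕ) (i : Fin M) : ℝ :=
  (∑ j : Fin M, ((C (i, j) : ℝ) + (C (j, i) : ℝ))) / (2 * N)

/-- The `k`-th empirical bin `I_k = {i : e^{k−1}/N ≤ ρ̂_i < e^k/N}` (for `k ≥ 1`). -/
def binSet (M N : ℕ) (C : (Fin M × Fin M) → ℕ) (k : ℕ) : Finset (Fin M) :=
  Finset.univ.filter fun i =>
    Real.exp ((k : ℝ) - 1) / N ≤ empMarg M N C i ∧ empMarg M N C i < Real.exp (k : ℝ) / N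

/-- The bin threshold `ρ̄_k = e^{k+1}/N`. -/
def binThresh (N k : ℕ) : ℝ := Real.exp ((k : ℝ) + 1) / N

/-- The true marginal probability `ρ_i = Σ_j B_{i,j}`. -/
def marg (M : ℕ) (B : Matrix (Fin M) (Fin M) ℝ) (i : Fin M) : ℝ := ∑ j, B i j

/-- The scaled count matrix `(1/N)·C`. -/
def scaledCount (M N : ℕ) (C : (Fin M × Fin M) → ℕ) : Matrix (Fin M) (Fin M) ℝ :=
  Matrix.of fun i j => (C (i, j) : ℝ) / N

/-- The set of words in bin `k` (bins from `Cb`) zeroed out by the regularization step applied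
to the counts `Cc`: words whose full row/column sum exceeds `2ρ̄_k`, or whose within-block
row/column sum exceeds `2|I_k|ρ̄_k²/w_min`. -/
def zeroedSet (M N : ℕ) (wmin : ℝ) (Cb Cc : (Fin M × Fin M) → ℕ) (k : ℕ) : Finset (Fin M) :=
  (binSet M N Cb k).filter fun i =>
    2 * binThresh N k < (∑ j : Fin M, (Cc (i, j) : ℝ)) / N ∨
    2 * binThresh N k < (∑ j : Fin M, (Cc (j, i) : ℝ)) / N ∨
    2 * ((binSet M N Cb k).card : ℝ) * binThresh N k ^ 2 / wmin <
      (∑ j ∈ binSet M N Cb k, (Cc (i, j) : ℝ)) / N ∨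
    2 * ((binSet M N Cb k).card : ℝ) * binThresh N k ^ 2 / wmin <
      (∑ j ∈ binSet M N Cb k, (Cc (j, i) : ℝ)) / N

/-- The regularized `k`-th diagonal block `B̃_k` (embedded as an `M×M` matrix supported on
`I_k × I_k`): the block of `(1/N)·Cc` on bin `I_k` (bins from `Cb`), with the zeroed-out
rows and columns set to `0`. -/
def regBlock (M N : ℕ) (wmin : ℝ) (Cb Cc : (Fin M × Fin M) → ℕ) (k : ℕ) :
    Matrix (Fin M) (Fin M) ℝ :=
  Matrix.of fun i j =>
    if i ∈ binSet M N Cb k ∧ j ∈ binSet M N Cb k ∧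
        i ∉ zeroedSet M N wmin Cb Cc k ∧ j ∉ zeroedSet M N wmin Cb Cc k then
      (Cc (i, j) : ℝ) / N
    else 0

/-- The restriction of a matrix to a block `S × S` (embedded as an `M×M` matrix). -/
def blockOf (M : ℕ) (A : Matrix (Fin M) (Fin M) ℝ) (S : Finset (Fin M)) :
    Matrix (Fin M) (Fin M) ℝ :=
  Matrix.of fun i j => if i ∈ S ∧ j ∈ S then A i j else 0

/-- Bin `k` is retained: `k ≥ kmin` and `|I_k| ≥ 20·e^{−3(k+1)/2}·N`. -/
def Retained (M N : ℕ) (kmin : ℝ) (Cb : (Fin M × Fin M) → ℕ) (k : ℕ) : Prop :=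
  kmin ≤ (k : ℝ) ∧
    20 * Real.exp (-(3 * ((k : ℝ) + 1)) / 2) * N ≤ ((binSet M N Cb k).card : ℝ)

/-- `k₀ = 4·log(c₀·R/(ε·√w_min)) + 16`. -/
def k0def (R : ℕ) (c0 ε wmin : ℝ) : ℝ :=
  4 * Real.log (c0 * R / (ε * Real.sqrt wmin)) + 16

/-- `Q` is a symmetric idempotent (orthogonal projection) matrix supported on `S × S`. -/
def IsProjOn (M : ℕ) (S : Finset (Fin M)) (Q : Matrix (Fin M) (Fin M) ℝ) : Prop :=
  Qᵀ = Q ∧ Q * Q = Q ∧ ∀ i j, (i ∉ S ∨ j ∉ S) → Q i j = 0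

/-- `Pk` is the orthogonal projection onto the span of the top `R` left singular vectors of `A`
(viewed as a block supported on `S`): among all rank-`≤ R` orthogonal projections supported on
`S`, it minimizes `‖A − Q·A‖`. -/
def IsTopRProj (M R : ℕ) (A : Matrix (Fin M) (Fin M) ℝ) (S : Finset (Fin M))
    (Pk : Matrix (Fin M) (Fin M) ℝ) : Prop :=
  IsProjOn M S Pk ∧ Pk.rank ≤ R ∧
    ∀ Q : Matrix (Fin M) (Fin M) ℝ, IsProjOn M S Q → Q.rank ≤ R →
      specNorm (A - Pk * A) ≤ specNorm (A - Q * A)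

/-- The block-diagonal projection `P_V` assembled from per-bin projections over retained bins. -/
def PVmat (M N : ℕ) (kmin : ℝ) (Cb : (Fin M × Fin M) → ℕ)
    (Pk : ℕ → Matrix (Fin M) (Fin M) ℝ) : Matrix (Fin M) (Fin M) ℝ :=
  ∑ k ∈ Finset.Icc 1 (Nat.floor (Real.log N)),
    if Retained M N kmin Cb k then Pk k else 0

/-- The block-diagonal scaling matrix `D` (`√ρ̄_k` on the coordinates of each retained bin,
`0` on discarded coordinates). -/
def Dmat (M N : ℕ) (kmin : ℝ) (Cb : (Fin M × Fin M) → ℕ) : Matrix (Fin M) (Fin M) ℝ :=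
  Matrix.diagonal fun i =>
    ∑ k ∈ Finset.Icc 1 (Nat.floor (Real.log N)),
      if i ∈ binSet M N Cb k ∧ Retained M N kmin Cb k then Real.sqrt (binThresh N k) else 0

/-- The block-diagonal scaling matrix `D^{−1}` (`1/√ρ̄_k` on the coordinates of each retained
bin, `0` on discarded coordinates). -/
def Dinv (M N : ℕ) (kmin : ℝ) (Cb : (Fin M × Fin M) → ℕ) : Matrix (Fin M) (Fin M) ℝ :=
  Matrix.diagonal fun i =>
    ∑ k ∈ Finset.Icc 1 (Nat.floor (Real.log N)),
      if i ∈ binSet M N Cb k ∧ Retained M N kmin Cb k then (Real.sqrt (binThresh N k))⁻¹ else 0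

open scoped NNReal

lemma lintegral_poissonMeasure (r : ℝ≥0) (f : ℕ → ℝ≥0∞) :
    ∫⁻ n, f n ∂poissonMeasure r =
      ∑' n : ℕ, ENNReal.ofReal (Real.exp (-r) * r ^ n / n.factorial) * f n := by
  simp [poissonMeasure, lintegral_sum_measure, lintegral_smul_measure, lintegral_dirac]

/-- Exponential tilting of a Poisson law. -/
lemma lintegral_pow_mul_poissonMeasure (r t : ℝ≥0) (f : ℕ → ℝ≥0∞) :
    ∫⁻ n, (t : ℝ≥0∞) ^ n * f n ∂poissonMeasure r =
      ENNReal.ofReal (Real.exp (r * (t - 1))) * ∫⁻ n, f n ∂poissonMeasure (r * t) := by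
  rw [lintegral_poissonMeasure, lintegral_poissonMeasure, ← ENNReal.tsum_mul_left]
  refine tsum_congr fun n => ?_
  have h1 : (t : ℝ≥0∞) ^ n = ENNReal.ofReal ((t : ℝ) ^ n) := by
    rw [ENNReal.ofReal_pow t.coe_nonneg, ENNReal.ofReal_coe_nnreal]
  rw [h1, ← mul_assoc, ← mul_assoc, ← ENNReal.ofReal_mul (by positivity),
    ← ENNReal.ofReal_mul (by positivity)]
  congr 2
  rw [show Real.exp (-(r : ℝ)) = Real.exp (r * (t - 1)) * Real.exp (-((r * t : ℝ≥0) : ℝ)) by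
    rw [← Real.exp_add]; push_cast; ring_nf]
  push_cast
  ring

lemma lintegral_add_poissonMeasure (r s : ℝ≥0) (f : ℕ → ℝ≥0∞) :
    ∫⁻ a, ∫⁻ b, f (a + b) ∂poissonMeasure s ∂poissonMeasure r =
      ∫⁻ n, f n ∂poissonMeasure (r + s) := by
  rw [← poissonMeasure_conv_poissonMeasure, Measure.lintegral_conv .of_discrete]

variable {ι : Type*} [DecidableEq ι]

/-- The tilted law of a sum of independent Poisson coordinates. -/
lemma lmarginal_tilt_sum (r t : ι → ℝ≥0) (s : Finset ι) (f : ℕ → ℝ≥0∞) (x₀ : ι → ℕ) [Finite ι] :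
    (∫⋯∫⁻_s, (fun x => (∏ e ∈ s, (t e : ℝ≥0∞) ^ x e) * f (∑ e ∈ s, x e))
        ∂fun e => poissonMeasure (r e)) x₀ =
      ENNReal.ofReal (Real.exp (∑ e ∈ s, (r e : ℝ) * (t e - 1))) *
        ∫⁻ n, f n ∂poissonMeasure (∑ e ∈ s, r e * t e) := by
  induction s using Finset.induction generalizing f x₀ with
  | empty =>
    rw [lmarginal_empty, lintegral_poissonMeasure, tsum_eq_single 0]
    · simp
    · intro n hn; simp [hn]
  | insert i s hi ih =>
    rw [lmarginal_insert _ .of_discrete hi]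
    have key : ∀ n : ℕ, (∫⋯∫⁻_s, (fun x => (∏ e ∈ insert i s, (t e : ℝ≥0∞) ^ x e) *
        f (∑ e ∈ insert i s, x e)) ∂fun e => poissonMeasure (r e)) (Function.update x₀ i n) =
        (t i : ℝ≥0∞) ^ n * (ENNReal.ofReal (Real.exp (∑ e ∈ s, (r e : ℝ) * (t e - 1))) *
          ∫⁻ m, f (n + m) ∂poissonMeasure (∑ e ∈ s, r e * t e)) := by
      intro n
      rw [← ih (fun m => f (n + m)) (Function.update x₀ i n)]
      simp only [lmarginal]
      rw [← lintegral_const_mul' _ _ (by finiteness)]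
      refine lintegral_congr fun y => ?_
      rw [Finset.prod_insert hi, Finset.sum_insert hi]
      have : Function.updateFinset (Function.update x₀ i n) s y i = n := by
        simp [Function.updateFinset, hi]
      rw [this, mul_assoc]
    simp_rw [key]
    rw [lintegral_pow_mul_poissonMeasure, lintegral_const_mul' _ _ (by finiteness),
      lintegral_add_poissonMeasure, ← mul_assoc, ← ENNReal.ofReal_mul (by positivity),
      ← Real.exp_add, Finset.sum_insert hi, Finset.sum_insert hi]

/-- Multiplicative exponential moment of a product of Poisson laws. -/
lemma lintegral_prod_pow [Fintype ι] (r t : ι → ℝ≥0) (s : Finset ι) :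
    ∫⁻ x, ∏ e ∈ s, (t e : ℝ≥0∞) ^ x e ∂Measure.pi (fun e => poissonMeasure (r e)) =
      ENNReal.ofReal (Real.exp (∑ e ∈ s, (r e : ℝ) * (t e - 1))) := by
  rw [lintegral_eq_of_lmarginal_eq s (g := fun _ =>
    ENNReal.ofReal (Real.exp (∑ e ∈ s, (r e : ℝ) * (t e - 1)))) .of_discrete .of_discrete]
  · simp
  · ext x₀
    have := lmarginal_tilt_sum r t s (fun _ => 1) x₀
    simp only [mul_one] at this
    rw [this]
    simp [lmarginal]

/-- A product of functions whose conditional means over their own blocks are at most one,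
each function being insensitive to the blocks of the others, has mean at most one. -/
lemma lintegral_prod_le_one_of_lmarginal [Fintype ι] {κ : Type*} (r : ι → ℝ≥0) (T : Finset κ)
    (b : κ → Finset ι) (φ : κ → (ι → ℕ) → ℝ≥0∞)
    (hdep : ∀ i ∈ T, ∀ j ∈ T, i ≠ j → ∀ x y, φ i (Function.updateFinset x (b j) y) = φ i x)
    (hle : ∀ j ∈ T, ∀ x, (∫⋯∫⁻_(b j), φ j ∂fun e => poissonMeasure (r e)) x ≤ 1) :
    ∫⁻ x, ∏ j ∈ T, φ j x ∂Measure.pi (fun e => poissonMeasure (r e)) ≤ 1 := by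
  induction T using Finset.induction with
  | empty => simp
  | insert j T hj ih =>
    refine le_trans ?_ (ih
      (fun i hi k hk => hdep i (Finset.mem_insert_of_mem hi) k (Finset.mem_insert_of_mem hk))
      (fun i hi => hle i (Finset.mem_insert_of_mem hi)))
    refine lintegral_le_of_lmarginal_le (b j) .of_discrete .of_discrete fun x => ?_
    have hT : ∀ y, ∏ i ∈ T, φ i (Function.updateFinset x (b j) y) = ∏ i ∈ T, φ i x := fun y =>
      Finset.prod_congr rfl fun i hi => hdep i (Finset.mem_insert_of_mem hi) j
        (Finset.mem_insert_self j T) (by rintro rfl; exact hj hi) x y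
    simp only [lmarginal, Finset.prod_insert hj, hT]
    rw [lintegral_mul_const _ .of_discrete, lintegral_const, measure_univ, mul_one]
    exact mul_le_of_le_one_left' (hle j (Finset.mem_insert_self j T) x)

/-- Conditionally on a capped total count, the exponential moment of a sub-count is bounded
by that of the corresponding binomial law. -/
lemma lmarginal_capped_tilt_le_one [Finite ι] (r : ι → ℝ≥0) (s u : Finset ι) (hsu : s ⊆ u)
    (t : ℝ≥0) (Q L κ : ℝ) (hQ : 0 ≤ Q) (hκ : L * Q ≤ κ)
    (ht : (∑ e ∈ s, (r e : ℝ)) * (t - 1) ≤ Q * ∑ e ∈ u, (r e : ℝ))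
    (J : ℕ → Prop) (hJ : ∀ n, J n → (n : ℝ) ≤ L) (x₀ : ι → ℕ) :
    (∫⋯∫⁻_u, (fun x => if J (∑ e ∈ u, x e) then
        ENNReal.ofReal (Real.exp (-κ)) * ∏ e ∈ s, (t : ℝ≥0∞) ^ x e else 1)
      ∂fun e => poissonMeasure (r e)) x₀ ≤ 1 := by
  set T : ι → ℝ≥0 := fun e => if e ∈ s then t else 1 with hT
  have hprod : ∀ x : ι → ℕ, ∏ e ∈ s, (t : ℝ≥0∞) ^ x e = ∏ e ∈ u, (T e : ℝ≥0∞) ^ x e := by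
    intro x
    rw [← Finset.prod_subset hsu (f := fun e => (T e : ℝ≥0∞) ^ x e)]
    · exact Finset.prod_congr rfl fun e he => by simp [hT, he]
    · intro e _ he; simp [hT, he]
  have hsum : ∑ e ∈ u, (r e : ℝ) * ((T e : ℝ) - 1) = (∑ e ∈ s, (r e : ℝ)) * (t - 1) := by
    rw [← Finset.sum_subset hsu (f := fun e => (r e : ℝ) * ((T e : ℝ) - 1)), Finset.sum_mul]
    · exact Finset.sum_congr rfl fun e he => by simp [hT, he]
    · intro e _ he; simp [hT, he]
  set f₁ : ℕ → ℝ≥0∞ := fun n => if J n then 0 else 1 with hf₁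
  set f₂ : ℕ → ℝ≥0∞ := fun n => if J n then ENNReal.ofReal (Real.exp (-κ)) else 0 with hf₂
  have h1 := lmarginal_tilt_sum r (fun _ => 1) u f₁ x₀
  have h2 := lmarginal_tilt_sum r T u f₂ x₀
  have hsplit : (∫⋯∫⁻_u, (fun x => if J (∑ e ∈ u, x e) then
        ENNReal.ofReal (Real.exp (-κ)) * ∏ e ∈ s, (t : ℝ≥0∞) ^ x e else 1)
      ∂fun e => poissonMeasure (r e)) x₀ =
      (∫⋯∫⁻_u, (fun x => (∏ e ∈ u, (((1 : ℝ≥0) : ℝ≥0∞)) ^ x e) * f₁ (∑ e ∈ u, x e))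
        ∂fun e => poissonMeasure (r e)) x₀ +
      (∫⋯∫⁻_u, (fun x => (∏ e ∈ u, (T e : ℝ≥0∞) ^ x e) * f₂ (∑ e ∈ u, x e))
        ∂fun e => poissonMeasure (r e)) x₀ := by
    simp only [lmarginal]
    rw [← lintegral_add_left .of_discrete]
    refine lintegral_congr fun y => ?_
    simp only [hprod, hf₁, hf₂]
    split_ifs <;> simp [mul_comm]
  set Λ : ℝ := ∑ e ∈ u, (r e : ℝ) with hΛ
  have hΛ0 : 0 ≤ Λ := Finset.sum_nonneg fun e _ => (r e).coe_nonneg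
  set Λ' : ℝ := ∑ e ∈ u, (r e : ℝ) * T e with hΛ'
  have hΛ'0 : 0 ≤ Λ' := Finset.sum_nonneg fun e _ => mul_nonneg (r e).coe_nonneg (T e).coe_nonneg
  have hdiff : ∑ e ∈ u, (r e : ℝ) * ((T e : ℝ) - 1) = Λ' - Λ := by
    rw [hΛ, hΛ', ← Finset.sum_sub_distrib]
    exact Finset.sum_congr rfl fun e _ => by ring
  have hΛ'le : Λ' ≤ (1 + Q) * Λ := by
    have : Λ' - Λ ≤ Q * Λ := by rw [← hdiff, hsum]; exact ht
    linarith
  have hpt : ENNReal.ofReal (Real.exp (Λ' - Λ)) *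
        ∫⁻ n, f₂ n ∂poissonMeasure (∑ e ∈ u, r e * T e) ≤
      ∫⁻ n, (if J n then 1 else 0) ∂poissonMeasure (∑ e ∈ u, r e) := by
    rw [lintegral_poissonMeasure, lintegral_poissonMeasure, ← ENNReal.tsum_mul_left]
    refine ENNReal.tsum_le_tsum fun n => ?_
    by_cases hn : J n
    · simp only [hf₂, hn, if_true, mul_one]
      rw [← ENNReal.ofReal_mul (by positivity), ← ENNReal.ofReal_mul (by positivity)]
      refine ENNReal.ofReal_le_ofReal ?_
      push_cast
      rw [← hΛ, ← hΛ']
      have e1 : Λ' ^ n ≤ Real.exp κ * Λ ^ n := by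
        calc Λ' ^ n ≤ ((1 + Q) * Λ) ^ n := by gcongr
          _ = (1 + Q) ^ n * Λ ^ n := mul_pow _ _ _
          _ ≤ Real.exp κ * Λ ^ n := by
              gcongr
              calc (1 + Q) ^ n ≤ (Real.exp Q) ^ n := by
                    gcongr; linarith [Real.add_one_le_exp Q]
                _ = Real.exp (n * Q) := (Real.exp_nat_mul _ _).symm
                _ ≤ Real.exp κ := by
                    gcongr
                    exact (mul_le_mul_of_nonneg_right (hJ n hn) hQ).trans hκ
      calc Real.exp (Λ' - Λ) * (Real.exp (-Λ') * Λ' ^ n / n.factorial * Real.exp (-κ))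
          = (Real.exp (-Λ) * Real.exp (-κ)) * Λ' ^ n / n.factorial := by
            rw [show Real.exp (-Λ) = Real.exp (Λ' - Λ) * Real.exp (-Λ') by
              rw [← Real.exp_add]; ring_nf]
            ring
        _ ≤ (Real.exp (-Λ) * Real.exp (-κ)) * (Real.exp κ * Λ ^ n) / n.factorial := by gcongr
        _ = Real.exp (-Λ) * Λ ^ n / n.factorial := by
            rw [Real.exp_neg κ]
            field_simp
    · simp [hf₂, hn]
  rw [hsplit, h1, h2, hdiff]
  refine (add_le_add_right hpt _).trans ?_
  simp only [NNReal.coe_one, sub_self, mul_zero, Finset.sum_const_zero, Real.exp_zero,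
    ENNReal.ofReal_one, one_mul, mul_one]
  rw [← lintegral_add_left .of_discrete]
  have : ∀ n, f₁ n + (if J n then 1 else 0) = 1 := by
    intro n; simp only [hf₁]; split_ifs <;> simp
  simp [this]

/-- The total count `Σ_j (C_{i,j} + C_{j,i})` of a word. -/
def degree {M : ℕ} (C : Fin M × Fin M → ℕ) (i : Fin M) : ℕ :=
  ∑ j, (C (i, j) + C (j, i))

lemma degree_eq_block_add {M : ℕ} (C : Fin M × Fin M → ℕ) (V : Finset (Fin M)) (j : Fin M) :
    degree C j = ∑ e ∈ Vᶜ ×ˢ {j}, C e + (∑ l ∈ V, C (l, j) + ∑ l, C (j, l)) := by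
  rw [degree, Finset.sum_add_distrib, Finset.sum_product,
    ← Finset.sum_add_sum_compl V (fun l => C (l, j))]
  simp only [Finset.sum_singleton]
  ring

set_option maxHeartbeats 1000000 in
/-- Exponential moment bound for the counts sent from `Z` to those words of `V` whose degree
satisfies a property `J`, once the word set `V` is separated from the modified rows. -/
lemma lintegral_prod_column_le_one {M : ℕ} (r : Fin M × Fin M → ℝ≥0) (Z V : Finset (Fin M))
    (hZV : Disjoint Z V) (t : Fin M → ℝ≥0) (Q L κ : ℝ) (hQ : 0 ≤ Q) (hκ : L * Q ≤ κ)
    (ht : ∀ j ∈ V, (∑ i ∈ Z, (r (i, j) : ℝ)) * (t j - 1) ≤ Q * ∑ l ∈ Vᶜ, (r (l, j) : ℝ))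
    (J : ℕ → Prop) (hJ : ∀ n, J n → (n : ℝ) ≤ L) :
    ∫⁻ C, ∏ j ∈ V, (if J (degree C j) then
        ENNReal.ofReal (Real.exp (-κ)) * ∏ i ∈ Z, (t j : ℝ≥0∞) ^ C (i, j) else 1)
      ∂Measure.pi (fun e => poissonMeasure (r e)) ≤ 1 := by
  set φ : Fin M → (Fin M × Fin M → ℕ) → ℝ≥0∞ := fun j C => if J (degree C j) then
        ENNReal.ofReal (Real.exp (-κ)) * ∏ i ∈ Z, (t j : ℝ≥0∞) ^ C (i, j) else 1 with hφ
  have h := lintegral_prod_le_one_of_lmarginal r V (fun j => Vᶜ ×ˢ {j}) φ ?_ ?_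
  · exact h
  · intro i hi j hj hij x y
    have hx : ∀ l, Function.updateFinset x (Vᶜ ×ˢ {j}) y (l, i) = x (l, i) := by
      intro l
      simp only [Function.updateFinset, Finset.mem_product, Finset.mem_singleton]
      rw [dif_neg fun h => hij h.2]
    have hx' : ∀ l, Function.updateFinset x (Vᶜ ×ˢ {j}) y (i, l) = x (i, l) := by
      intro l; simp [Function.updateFinset, hi]
    have hdeg : degree (Function.updateFinset x (Vᶜ ×ˢ {j}) y) i = degree x i := by
      simp only [degree, hx, hx']
    simp only [hφ, hdeg, hx]
  · intro j hj x
    have hsub : Z ×ˢ {j} ⊆ Vᶜ ×ˢ ({j} : Finset (Fin M)) :=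
      Finset.product_subset_product_left
        (Finset.subset_compl_iff_disjoint_right.2 hZV)
    have := lmarginal_capped_tilt_le_one r (Z ×ˢ {j}) (Vᶜ ×ˢ {j}) hsub (t j) Q L κ hQ hκ
      (by simpa [Finset.sum_product] using ht j hj)
      (fun n => J (n + (∑ l ∈ V, x (l, j) + ∑ l, x (j, l))))
      (fun n hn => le_trans (Nat.cast_le.2 (Nat.le_add_right _ _)) (hJ _ hn)) x
    refine le_trans (le_of_eq ?_) this
    simp only [lmarginal, hφ]
    refine lintegral_congr fun y => ?_
    have hx : ∀ l : Fin M, l ∈ V → Function.updateFinset x (Vᶜ ×ˢ {j}) y (l, j) = x (l, j) := by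
      intro l hl; simp [Function.updateFinset, hl]
    have hx' : ∀ l : Fin M, Function.updateFinset x (Vᶜ ×ˢ {j}) y (j, l) = x (j, l) := by
      intro l; simp [Function.updateFinset, hj]
    rw [degree_eq_block_add _ V j]
    have h1 := Finset.sum_congr rfl hx
    have h2 : ∑ l, Function.updateFinset x (Vᶜ ×ˢ {j}) y (j, l) = ∑ l, x (j, l) :=
      Finset.sum_congr rfl fun l _ => hx' l
    have h3 : ∏ i ∈ Z, (t j : ℝ≥0∞) ^ Function.updateFinset x (Vᶜ ×ˢ {j}) y (i, j) =
        ∏ e ∈ Z ×ˢ {j}, (t j : ℝ≥0∞) ^ Function.updateFinset x (Vᶜ ×ˢ {j}) y e := by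
      rw [Finset.prod_product]
      exact Finset.prod_congr rfl fun i _ => (Finset.prod_singleton _ _).symm
    rw [h1, h2, h3]

/-- The probability that a random subset of a finite type, containing each element independently
with probability `p`, equals `s`. -/
def bernWeight {α : Type*} [Fintype α] [DecidableEq α] (p : ℝ) (s : Finset α) : ℝ :=
  p ^ s.card * (1 - p) ^ (Finset.univ \ s).card

lemma sum_bernWeight {α : Type*} [Fintype α] [DecidableEq α] (p : ℝ) :
    ∑ s : Finset α, bernWeight p s = 1 := by
  have h := Finset.prod_add (fun _ : α => p) (fun _ => 1 - p) Finset.univ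
  simp only [Finset.prod_const, Finset.powerset_univ] at h
  simp only [bernWeight, ← h]
  simp

lemma sum_bernWeight_mem {α : Type*} [Fintype α] [DecidableEq α] (p : ℝ) (j : α) :
    ∑ s : Finset α, bernWeight p s * (if j ∈ s then 1 else 0) = p := by
  have h := Finset.prod_add (fun _ : α => p) (fun i => (1 - p) * (if i = j then 0 else 1))
    Finset.univ
  simp only [Finset.prod_const, Finset.powerset_univ, Finset.prod_mul_distrib,
    Finset.prod_ite_eq', Finset.mem_sdiff, Finset.mem_univ, true_and] at h
  have hL : ∏ i : α, (p + (1 - p) * (if i = j then 0 else 1)) = p := by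
    rw [Finset.prod_congr rfl (g := fun i => if i = j then p else 1)]
    · simp
    · intro i _; split_ifs <;> ring
  refine Eq.trans (Finset.sum_congr rfl fun s _ => ?_) (h.symm.trans hL)
  simp only [bernWeight]
  by_cases hj : j ∈ s <;> simp [hj]

lemma sum_bernWeight_mem_notMem {α : Type*} [Fintype α] [DecidableEq α] (p : ℝ) {j l : α}
    (hjl : j ≠ l) :
    ∑ s : Finset α, bernWeight p s * (if j ∈ s ∧ l ∉ s then 1 else 0) = p * (1 - p) := by
  have h := Finset.prod_add (fun i : α => p * (if i = l then 0 else 1))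
    (fun i => (1 - p) * (if i = j then 0 else 1)) Finset.univ
  simp only [Finset.prod_const, Finset.powerset_univ, Finset.prod_mul_distrib,
    Finset.prod_ite_eq', Finset.mem_sdiff, Finset.mem_univ, true_and] at h
  have hL : ∏ i : α, (p * (if i = l then 0 else 1) + (1 - p) * (if i = j then 0 else 1)) =
      p * (1 - p) := by
    rw [Finset.prod_congr rfl
      (g := fun i => (if i = j then p else 1) * (if i = l then (1 - p) else 1))]
    · rw [Finset.prod_mul_distrib, Finset.prod_ite_eq', Finset.prod_ite_eq']
      simp
    · intro i _
      by_cases h1 : i = j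
      · subst h1; simp [hjl]
      · by_cases h2 : i = l
        · subst h2; simp [hjl.symm]
        · simp [h1, h2]
  refine Eq.trans (Finset.sum_congr rfl fun s _ => ?_) (h.symm.trans hL)
  simp only [bernWeight]
  by_cases hj : j ∈ s <;> by_cases hl : l ∈ s <;> simp [hj, hl]

lemma bernWeight_nonneg {α : Type*} [Fintype α] [DecidableEq α] {p : ℝ} (h0 : 0 ≤ p)
    (h1 : p ≤ 1) (s : Finset α) : 0 ≤ bernWeight p s :=
  mul_nonneg (pow_nonneg h0 _) (pow_nonneg (by linarith) _)

/-- A symmetric nonnegative matrix whose entries are dominated by the product of its marginals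
divided by `w`. -/
structure MargDominated (M : ℕ) (B : Matrix (Fin M) (Fin M) ℝ) (w : ℝ) : Prop where
  nonneg : ∀ i j, 0 ≤ B i j
  symm : ∀ i j, B i j = B j i
  w_pos : 0 < w
  le : ∀ i j, B i j * w ≤ marg M B i * marg M B j

lemma MargDominated.marg_nonneg {M : ℕ} {B : Matrix (Fin M) (Fin M) ℝ} {w : ℝ}
    (hB : MargDominated M B w) (i : Fin M) : 0 ≤ marg M B i :=
  Finset.sum_nonneg fun j _ => hB.nonneg i j

lemma MargDominated.sum_col {M : ℕ} {B : Matrix (Fin M) (Fin M) ℝ} {w : ℝ}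
    (hB : MargDominated M B w) (j : Fin M) : ∑ l, B l j = marg M B j :=
  Finset.sum_congr rfl fun l _ => hB.symm l j

lemma exp_mul_sub_one_le {a h : ℝ} (h0 : 0 ≤ h) (h1 : h ≤ 1) :
    Real.exp (a * h) - 1 ≤ h * (Real.exp a - 1) := by
  have := convexOn_exp.2 (Set.mem_univ 0) (Set.mem_univ a) (sub_nonneg.2 h1) h0 (by ring)
  simp only [smul_eq_mul, mul_zero, zero_add, Real.exp_zero, mul_one] at this
  rw [mul_comm a h]; linarith

/-- The proportion of the mass of column `j` carried by the rows outside `V`. -/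
def outerShare {M : ℕ} (B : Matrix (Fin M) (Fin M) ℝ) (V : Finset (Fin M)) (j : Fin M) : ℝ :=
  if marg M B j = 0 then 1 else (∑ l ∈ Vᶜ, B l j) / marg M B j

lemma outerShare_nonneg {M : ℕ} {B : Matrix (Fin M) (Fin M) ℝ} {w : ℝ}
    (hB : MargDominated M B w) (V : Finset (Fin M)) (j : Fin M) : 0 ≤ outerShare B V j := by
  unfold outerShare
  split_ifs
  · exact zero_le_one
  · exact div_nonneg (Finset.sum_nonneg fun l _ => hB.nonneg l j) (hB.marg_nonneg j)

lemma outerShare_le_one {M : ℕ} {B : Matrix (Fin M) (Fin M) ℝ} {w : ℝ}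
    (hB : MargDominated M B w) (V : Finset (Fin M)) (j : Fin M) : outerShare B V j ≤ 1 := by
  unfold outerShare
  split_ifs
  · exact le_rfl
  · refine div_le_one_of_le₀ ?_ (hB.marg_nonneg j)
    rw [← hB.sum_col j]
    exact Finset.sum_le_sum_of_subset_of_nonneg (Finset.subset_univ _)
      fun l _ _ => hB.nonneg l j

lemma marg_mul_outerShare {M : ℕ} {B : Matrix (Fin M) (Fin M) ℝ} {w : ℝ}
    (hB : MargDominated M B w) (V : Finset (Fin M)) (j : Fin M) :
    marg M B j * outerShare B V j = ∑ l ∈ Vᶜ, B l j := by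
  unfold outerShare
  split_ifs with h
  · have : ∀ l, B l j = 0 := fun l =>
      (Finset.sum_eq_zero_iff_of_nonneg fun l _ => hB.nonneg l j).1 ((hB.sum_col j).trans h) l
        (Finset.mem_univ l)
    simp [h, this]
  · field_simp

/-- The exponent controlling the counts sent from `Z` to the words of `V` whose degree
satisfies `J`. -/
def crossExponent {M : ℕ} (B : Matrix (Fin M) (Fin M) ℝ) (Z V : Finset (Fin M)) (J : ℕ → Prop)
    (κ : ℝ) (C : Fin M × Fin M → ℕ) : ℝ :=
  ∑ j ∈ V, if J (degree C j) then
    1 / 2 * outerShare B V j * (∑ i ∈ Z, (C (i, j) : ℝ)) - κ else 0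

lemma lintegral_exp_crossExponent_le_one {M N : ℕ} {B : Matrix (Fin M) (Fin M) ℝ} {w : ℝ}
    (hB : MargDominated M B w) (Z V : Finset (Fin M)) (hZV : Disjoint Z V) (q L : ℝ)
    (hq0 : 0 ≤ q) (hq : ∀ j, ∑ i ∈ Z, B i j ≤ q * marg M B j)
    (J : ℕ → Prop) (hJ : ∀ n, J n → (n : ℝ) ≤ L) :
    ∫⁻ C, ENNReal.ofReal (Real.exp
        (crossExponent B Z V J (L * (q * (Real.exp (1 / 2) - 1))) C)) ∂countMeasure M N B ≤ 1 := by
  have he : (0 : ℝ) ≤ Real.exp (1 / 2) - 1 := by linarith [Real.add_one_le_exp (1 / 2 : ℝ)]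
  have hcoe : ∀ i j, (((N : ℝ) * B i j).toNNReal : ℝ) = N * B i j := fun i j =>
    Real.coe_toNNReal _ (mul_nonneg N.cast_nonneg (hB.nonneg i j))
  have key := lintegral_prod_column_le_one
    (fun e : Fin M × Fin M => ((N : ℝ) * B e.1 e.2).toNNReal) Z V hZV
    (fun j => (Real.exp (1 / 2 * outerShare B V j)).toNNReal)
    (q * (Real.exp (1 / 2) - 1)) L _ (mul_nonneg hq0 he) le_rfl ?_ J hJ
  · refine le_trans (le_of_eq ?_) key
    refine lintegral_congr fun C => ?_
    rw [crossExponent, Real.exp_sum, ENNReal.ofReal_prod_of_nonneg fun _ _ => (Real.exp_pos _).le]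
    refine Finset.prod_congr rfl fun j _ => ?_
    split_ifs
    · rw [sub_eq_neg_add, Real.exp_add, ENNReal.ofReal_mul (Real.exp_pos _).le, Finset.mul_sum,
        Real.exp_sum, ENNReal.ofReal_prod_of_nonneg fun _ _ => (Real.exp_pos _).le]
      congr 1
      refine Finset.prod_congr rfl fun i _ => ?_
      rw [mul_comm _ (C (i, j) : ℝ), Real.exp_nat_mul, ENNReal.ofReal_pow (Real.exp_pos _).le]
      rfl
    · simp
  · intro j _
    rw [Real.coe_toNNReal _ (Real.exp_pos _).le]
    simp only [hcoe, ← Finset.mul_sum]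
    rw [← marg_mul_outerShare hB]
    have h1 := exp_mul_sub_one_le (a := 1 / 2) (outerShare_nonneg hB V j)
      (outerShare_le_one hB V j)
    have h2 : 0 ≤ ∑ i ∈ Z, B i j := Finset.sum_nonneg fun i _ => hB.nonneg i j
    have h3 := outerShare_nonneg hB V j
    have h4 : 0 ≤ outerShare B V j * (Real.exp (1 / 2) - 1) := mul_nonneg h3 he
    calc N * (∑ i ∈ Z, B i j) * (Real.exp (1 / 2 * outerShare B V j) - 1)
        = N * ((∑ i ∈ Z, B i j) * (Real.exp (1 / 2 * outerShare B V j) - 1)) := by ring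
      _ ≤ N * ((q * marg M B j) * (outerShare B V j * (Real.exp (1 / 2) - 1))) := by
          refine mul_le_mul_of_nonneg_left ?_ N.cast_nonneg
          exact (mul_le_mul_of_nonneg_left h1 h2).trans (mul_le_mul_of_nonneg_right (hq j) h4)
      _ = q * (Real.exp (1 / 2) - 1) * (N * (marg M B j * outerShare B V j)) := by ring

lemma le_sum_bernWeight_outerShare {M : ℕ} {B : Matrix (Fin M) (Fin M) ℝ} {w : ℝ}
    (hB : MargDominated M B w) (Z : Finset (Fin M)) (j : Fin M) (τ : ℝ) (hτ0 : 0 ≤ τ)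
    (hτ : marg M B j ≤ τ * w) :
    1 / 4 * (3 / 4) * (1 - τ) ≤
      ∑ s : Finset (Fin M), bernWeight (1 / 4) s * (if j ∈ s then outerShare B (s \ Z) j else 0) := by
  by_cases h0 : marg M B j = 0
  · have : ∀ s : Finset (Fin M), (if j ∈ s then outerShare B (s \ Z) j else 0) =
        if j ∈ s then (1 : ℝ) else 0 := by intro s; simp [outerShare, h0]
    simp only [this, sum_bernWeight_mem]
    linarith
  have hpos : 0 < marg M B j := lt_of_le_of_ne (hB.marg_nonneg j) (Ne.symm h0)
  have hjj : B j j ≤ τ * marg M B j := by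
    have h1 := hB.le j j
    have h2 := mul_le_mul_of_nonneg_left hτ hpos.le
    have h3 : B j j * w ≤ (τ * marg M B j) * w := by nlinarith
    exact le_of_mul_le_mul_right h3 hB.w_pos
  have hterm : ∀ s : Finset (Fin M), ∑ l ∈ Finset.univ.erase j, (B l j / marg M B j) *
      (if j ∈ s ∧ l ∉ s then 1 else 0) ≤ if j ∈ s then outerShare B (s \ Z) j else 0 := by
    intro s
    by_cases hj : j ∈ s
    · simp only [hj, true_and, if_true, outerShare, h0, if_false, mul_ite, mul_one, mul_zero]
      rw [Finset.sum_div, ← Finset.sum_filter]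
      refine Finset.sum_le_sum_of_subset_of_nonneg ?_
        fun l _ _ => div_nonneg (hB.nonneg l j) hpos.le
      intro l hl
      simp only [Finset.mem_filter] at hl
      simp [hl.2]
    · simp [hj]
  calc 1 / 4 * (3 / 4) * (1 - τ)
      ≤ 1 / 4 * (3 / 4) * (∑ l ∈ Finset.univ.erase j, B l j / marg M B j) := by
        gcongr
        rw [← Finset.sum_div, le_div_iff₀ hpos]
        have := Finset.add_sum_erase Finset.univ (fun l => B l j) (Finset.mem_univ j)
        rw [hB.sum_col] at this
        linarith
    _ = ∑ l ∈ Finset.univ.erase j, (B l j / marg M B j) *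
          ∑ s : Finset (Fin M), bernWeight (1 / 4) s * (if j ∈ s ∧ l ∉ s then 1 else 0) := by
        rw [Finset.mul_sum]
        refine Finset.sum_congr rfl fun l hl => ?_
        rw [sum_bernWeight_mem_notMem _ (Finset.ne_of_mem_erase hl).symm]
        norm_num
        ring
    _ = ∑ s : Finset (Fin M), bernWeight (1 / 4) s * ∑ l ∈ Finset.univ.erase j,
          (B l j / marg M B j) * (if j ∈ s ∧ l ∉ s then 1 else 0) := by
        simp only [Finset.mul_sum]
        rw [Finset.sum_comm]
        exact Finset.sum_congr rfl fun _ _ => Finset.sum_congr rfl fun _ _ => by ring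
    _ ≤ _ := Finset.sum_le_sum fun s _ => mul_le_mul_of_nonneg_left (hterm s)
        (bernWeight_nonneg (by norm_num) (by norm_num) s)

/-- Tail bound for the counts sent from `Z` to the other words whose degree satisfies `J`,
obtained by averaging over random separations of the vocabulary. -/
lemma countMeasure_cross_le {M N : ℕ} {B : Matrix (Fin M) (Fin M) ℝ} {w : ℝ}
    (hB : MargDominated M B w) (Z : Finset (Fin M)) (q L τ y : ℝ)
    (hq0 : 0 ≤ q) (hq : ∀ j, ∑ i ∈ Z, B i j ≤ q * marg M B j)
    (J : ℕ → Prop) (hJ : ∀ n, J n → (n : ℝ) ≤ L) (hτ0 : 0 ≤ τ) :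
    countMeasure M N B {C | (∀ j, J (degree C j) → marg M B j ≤ τ * w) ∧
      y ≤ 1 / 4 * ∑ j ∈ Zᶜ, if J (degree C j) then
        1 / 2 * (3 / 4) * (1 - τ) * (∑ i ∈ Z, (C (i, j) : ℝ)) -
          L * (q * (Real.exp (1 / 2) - 1)) else 0} ≤ ENNReal.ofReal (Real.exp (-y)) := by
  set κ : ℝ := L * (q * (Real.exp (1 / 2) - 1)) with hκ
  set F : (Fin M × Fin M → ℕ) → ℝ≥0∞ := fun C => ∑ s : Finset (Fin M),
    ENNReal.ofReal (bernWeight (1 / 4) s) *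
      ENNReal.ofReal (Real.exp (crossExponent B Z (s \ Z) J κ C)) with hF
  have hw : ∀ s : Finset (Fin M), 0 ≤ bernWeight (1 / 4) s :=
    bernWeight_nonneg (by norm_num) (by norm_num)
  have hint : ∫⁻ C, F C ∂countMeasure M N B ≤ 1 := by
    rw [hF, lintegral_finsetSum _ fun _ _ => .of_discrete]
    calc ∑ s : Finset (Fin M), ∫⁻ C, ENNReal.ofReal (bernWeight (1 / 4) s) *
          ENNReal.ofReal (Real.exp (crossExponent B Z (s \ Z) J κ C)) ∂countMeasure M N B
        ≤ ∑ s : Finset (Fin M), ENNReal.ofReal (bernWeight (1 / 4) s) := by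
          refine Finset.sum_le_sum fun s _ => ?_
          rw [lintegral_const_mul _ .of_discrete]
          exact mul_le_of_le_one_right' (lintegral_exp_crossExponent_le_one hB Z (s \ Z)
            Finset.disjoint_sdiff q L hq0 hq J hJ)
      _ = 1 := by
          rw [← ENNReal.ofReal_sum_of_nonneg fun s _ => hw s, sum_bernWeight, ENNReal.ofReal_one]
  have hsub : {C | (∀ j, J (degree C j) → marg M B j ≤ τ * w) ∧
      y ≤ 1 / 4 * ∑ j ∈ Zᶜ, if J (degree C j) then
        1 / 2 * (3 / 4) * (1 - τ) * (∑ i ∈ Z, (C (i, j) : ℝ)) - κ else 0} ⊆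
      {C | ENNReal.ofReal (Real.exp y) ≤ F C} := by
    rintro C ⟨hC, hy⟩
    have h1 : F C = ENNReal.ofReal (∑ s : Finset (Fin M), bernWeight (1 / 4) s *
        Real.exp (crossExponent B Z (s \ Z) J κ C)) := by
      rw [ENNReal.ofReal_sum_of_nonneg fun s _ => mul_nonneg (hw s) (Real.exp_pos _).le]
      exact Finset.sum_congr rfl fun s _ => (ENNReal.ofReal_mul (hw s)).symm
    have h2 := convexOn_exp.map_sum_le (t := Finset.univ) (w := bernWeight (1 / 4))
      (p := fun s : Finset (Fin M) => crossExponent B Z (s \ Z) J κ C)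
      (fun s _ => hw s) (sum_bernWeight _) (fun _ _ => Set.mem_univ _)
    simp only [smul_eq_mul] at h2
    rw [Set.mem_ofPred_eq, h1]
    refine ENNReal.ofReal_le_ofReal (le_trans (Real.exp_le_exp.2 (hy.trans ?_)) h2)
    have h3 : ∀ s : Finset (Fin M), crossExponent B Z (s \ Z) J κ C =
        ∑ j ∈ Zᶜ, if J (degree C j) then (if j ∈ s then
          1 / 2 * outerShare B (s \ Z) j * (∑ i ∈ Z, (C (i, j) : ℝ)) - κ else 0) else 0 := by
      intro s
      rw [crossExponent, show s \ Z = Zᶜ.filter (· ∈ s) by ext; simp [and_comm],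
        Finset.sum_filter]
      refine Finset.sum_congr rfl fun j _ => ?_
      split_ifs <;> rfl
    simp only [h3, Finset.mul_sum (s := Zᶜ)]
    rw [Finset.sum_comm]
    refine Finset.sum_le_sum fun j _ => ?_
    by_cases hJj : J (degree C j)
    · simp only [hJj, if_true]
      have h4 := le_sum_bernWeight_outerShare hB Z j τ hτ0 (hC j hJj)
      have h5 := sum_bernWeight_mem (1 / 4) j
      set X : ℝ := ∑ i ∈ Z, (C (i, j) : ℝ) with hX
      have hX0 : 0 ≤ X := Finset.sum_nonneg fun _ _ => Nat.cast_nonneg _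
      clear_value X
      calc 1 / 4 * (1 / 2 * (3 / 4) * (1 - τ) * X - κ)
          = (1 / 2 * X) * (1 / 4 * (3 / 4) * (1 - τ)) - κ * (1 / 4) := by ring
        _ ≤ (1 / 2 * X) * (∑ s : Finset (Fin M), bernWeight (1 / 4) s *
              (if j ∈ s then outerShare B (s \ Z) j else 0)) -
            κ * ∑ s : Finset (Fin M), bernWeight (1 / 4) s * (if j ∈ s then 1 else 0) := by
            rw [h5]; gcongr
        _ = _ := by
            rw [Finset.mul_sum, Finset.mul_sum, ← Finset.sum_sub_distrib]
            refine Finset.sum_congr rfl fun s _ => ?_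
            split_ifs <;> ring
    · simp [hJj]
  have hE : ENNReal.ofReal (Real.exp y) ≠ 0 := by simp [Real.exp_pos]
  refine (measure_mono hsub).trans ?_
  refine (meas_ge_le_lintegral_div Measurable.of_discrete.aemeasurable hE
    ENNReal.ofReal_ne_top).trans ?_
  rw [Real.exp_neg, ENNReal.ofReal_inv_of_pos (Real.exp_pos _), ← one_div]
  gcongr

lemma countMeasure_exp_sum {M N : ℕ} {B : Matrix (Fin M) (Fin M) ℝ} (hB : ∀ i j, 0 ≤ B i j)
    (s : Finset (Fin M × Fin M)) (t : ℝ) :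
    ∫⁻ C, ENNReal.ofReal (Real.exp (t * ∑ e ∈ s, (C e : ℝ))) ∂countMeasure M N B =
      ENNReal.ofReal (Real.exp (N * (∑ e ∈ s, B e.1 e.2) * (Real.exp t - 1))) := by
  have h := lintegral_prod_pow (fun e : Fin M × Fin M => ((N : ℝ) * B e.1 e.2).toNNReal)
    (fun _ => (Real.exp t).toNNReal) s
  have h1 : N * (∑ e ∈ s, B e.1 e.2) * (Real.exp t - 1) =
      ∑ e ∈ s, ((((N : ℝ) * B e.1 e.2).toNNReal : ℝ)) * (((Real.exp t).toNNReal : ℝ) - 1) := by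
    rw [Real.coe_toNNReal _ (Real.exp_pos _).le, ← Finset.sum_mul, Finset.mul_sum]
    congr 1
    exact Finset.sum_congr rfl fun e _ =>
      (Real.coe_toNNReal _ (mul_nonneg N.cast_nonneg (hB _ _))).symm
  rw [h1, ← h]
  refine lintegral_congr fun C => ?_
  rw [Finset.mul_sum, Real.exp_sum, ENNReal.ofReal_prod_of_nonneg fun _ _ => (Real.exp_pos _).le]
  refine Finset.prod_congr rfl fun e _ => ?_
  rw [mul_comm t, Real.exp_nat_mul, ENNReal.ofReal_pow (Real.exp_pos _).le]
  rfl

/-- Chernoff's bound for a sum of entries of the count matrix. -/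
lemma countMeasure_chernoff {M N : ℕ} {B : Matrix (Fin M) (Fin M) ℝ} (hB : ∀ i j, 0 ≤ B i j)
    (s : Finset (Fin M × Fin M)) (t y : ℝ) :
    countMeasure M N B {C | y ≤ t * ∑ e ∈ s, (C e : ℝ)} ≤
      ENNReal.ofReal (Real.exp (N * (∑ e ∈ s, B e.1 e.2) * (Real.exp t - 1) - y)) := by
  have hE : ENNReal.ofReal (Real.exp y) ≠ 0 := by simp [Real.exp_pos]
  have hsub : {C : Fin M × Fin M → ℕ | y ≤ t * ∑ e ∈ s, (C e : ℝ)} ⊆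
      {C | ENNReal.ofReal (Real.exp y) ≤
        ENNReal.ofReal (Real.exp (t * ∑ e ∈ s, (C e : ℝ)))} := fun C hC =>
    ENNReal.ofReal_le_ofReal (Real.exp_le_exp.2 hC)
  refine (measure_mono hsub).trans ?_
  refine (meas_ge_le_lintegral_div Measurable.of_discrete.aemeasurable hE
    ENNReal.ofReal_ne_top).trans ?_
  rw [countMeasure_exp_sum hB, ← ENNReal.ofReal_div_of_pos (Real.exp_pos _), ← Real.exp_sub]

lemma countMeasure_upper_tail_le {M N : ℕ} {B : Matrix (Fin M) (Fin M) ℝ}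
    (hB : ∀ i j, 0 ≤ B i j) (s : Finset (Fin M × Fin M)) (b y : ℝ)
    (hb : N * (∑ e ∈ s, B e.1 e.2) ≤ b) :
    countMeasure M N B {C | y ≤ ∑ e ∈ s, (C e : ℝ)} ≤
      ENNReal.ofReal (Real.exp (b * (Real.exp 1 - 1) - y)) := by
  have h := countMeasure_chernoff (N := N) hB s 1 y
  simp only [one_mul] at h
  refine h.trans (ENNReal.ofReal_le_ofReal (Real.exp_le_exp.2 ?_))
  have : 0 ≤ Real.exp 1 - 1 := by linarith [Real.add_one_le_exp (1 : ℝ)]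
  have := mul_le_mul_of_nonneg_right hb this
  linarith

lemma countMeasure_lower_tail_le {M N : ℕ} {B : Matrix (Fin M) (Fin M) ℝ}
    (hB : ∀ i j, 0 ≤ B i j) (s : Finset (Fin M × Fin M)) (b : ℝ) (hb0 : 0 ≤ b)
    (hb : b ≤ N * (∑ e ∈ s, B e.1 e.2)) :
    countMeasure M N B {C | ∑ e ∈ s, (C e : ℝ) ≤ b / 2} ≤
      ENNReal.ofReal (Real.exp (-(3 / 20 * b))) := by
  have h := countMeasure_chernoff (N := N) hB s (-Real.log 2) (-Real.log 2 * (b / 2))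
  have hlog : 0 < Real.log 2 := Real.log_pos (by norm_num)
  have hsub : {C : Fin M × Fin M → ℕ | ∑ e ∈ s, (C e : ℝ) ≤ b / 2} ⊆
      {C | -Real.log 2 * (b / 2) ≤ -Real.log 2 * ∑ e ∈ s, (C e : ℝ)} := fun C hC => by
    have := mul_le_mul_of_nonneg_left (Set.mem_ofPred_eq ▸ hC : _ ≤ b / 2) hlog.le
    rw [Set.mem_ofPred_eq]
    linarith
  refine (measure_mono hsub).trans (h.trans (ENNReal.ofReal_le_ofReal (Real.exp_le_exp.2 ?_)))
  rw [Real.exp_neg, Real.exp_log (by norm_num)]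
  nlinarith [Real.log_two_lt_d9]

instance {M N : ℕ} {B : Matrix (Fin M) (Fin M) ℝ} : IsProbabilityMeasure (countMeasure M N B) := by
  unfold countMeasure; infer_instance

/-- The law of the count matrix is invariant under transposition. -/
lemma countMeasure_preimage_swap {M N : ℕ} {B : Matrix (Fin M) (Fin M) ℝ}
    (hB : ∀ i j, B i j = B j i) (S : Set (Fin M × Fin M → ℕ)) :
    countMeasure M N B ((fun C => C ∘ Prod.swap) ⁻¹' S) = countMeasure M N B S := by
  have h := measurePreserving_piCongrLeft
    (fun p : Fin M × Fin M => poissonMeasure ((N : ℝ) * B p.1 p.2).toNNReal)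
    (Equiv.prodComm (Fin M) (Fin M))
  have h1 : (Measure.pi fun p : Fin M × Fin M =>
      poissonMeasure ((N : ℝ) * B (Equiv.prodComm (Fin M) (Fin M) p).1
        (Equiv.prodComm (Fin M) (Fin M) p).2).toNNReal) = countMeasure M N B := by
    unfold countMeasure
    congr 1
    ext1 p
    simp [hB p.2 p.1]
  have h2 := h.measure_preimage (s := S) MeasurableSet.of_discrete.nullMeasurableSet
  rw [h1] at h2
  exact h2

/-- The union bound over the columns or rows of a lower tail event for the degrees. -/
lemma countMeasure_sum_degree_lt_le {M N : ℕ} {B : Matrix (Fin M) (Fin M) ℝ} {w : ℝ}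
    (hB : MargDominated M B w) (Z : Finset (Fin M)) (b : ℝ) (hb0 : 0 ≤ b)
    (hb : b ≤ N * ∑ i ∈ Z, marg M B i) :
    countMeasure M N B {C | ∑ i ∈ Z, (degree C i : ℝ) < b} ≤
      2 * ENNReal.ofReal (Real.exp (-(3 / 20 * b))) := by
  have h1 := countMeasure_lower_tail_le (N := N) hB.nonneg (Z ×ˢ Finset.univ) b hb0
    (by rw [Finset.sum_product]; exact hb)
  have h2 := countMeasure_lower_tail_le (N := N) hB.nonneg (Finset.univ ×ˢ Z) b hb0
    (by rw [Finset.sum_product_right]; simp only [hB.sum_col]; exact hb)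
  rw [two_mul]
  refine le_trans (measure_mono ?_) ((measure_union_le _ _).trans (add_le_add h1 h2))
  intro C hC
  simp only [Set.mem_ofPred_eq, degree, Nat.cast_sum, Nat.cast_add, Finset.sum_add_distrib] at hC
  simp only [Set.mem_union, Set.mem_ofPred_eq]
  rw [Finset.sum_product, Finset.sum_product_right]
  by_contra! h
  linarith [h.1, h.2]

/-- The words whose degree satisfies `J`. -/
def degreeBin {M : ℕ} (J : ℕ → Prop) (C : Fin M × Fin M → ℕ) : Finset (Fin M) :=
  Finset.univ.filter fun i => J (degree C i)

lemma two_mul_exp_neg_two_le : 2 * Real.exp (-2) ≤ 0.2707 := by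
  have h1 := Real.exp_one_gt_d9
  have h2 : Real.exp (-2) * (Real.exp 1 * Real.exp 1) = 1 := by
    rw [← Real.exp_add, ← Real.exp_add]; norm_num
  have h3 := Real.exp_pos (-2)
  nlinarith [mul_self_nonneg (Real.exp 1 - 2.7182818283)]

lemma exp_half_sub_one_le : Real.exp (1 / 2) - 1 ≤ 0.6488 := by
  have h1 := Real.exp_one_lt_d9
  have h2 : Real.exp (1 / 2) * Real.exp (1 / 2) = Real.exp 1 := by
    rw [← Real.exp_add]; norm_num
  nlinarith [Real.exp_pos (1 / 2 : ℝ)]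

/-- It is unlikely that the rows of `Z` send too many counts into a bin containing `Z`. -/
lemma countMeasure_heavy_rows_le {M N : ℕ} (hN : 0 < N) {B : Matrix (Fin M) (Fin M) ℝ} {w : ℝ}
    (hB : MargDominated M B w) (Z : Finset (Fin M)) (J : ℕ → Prop) (L θ n₀ : ℝ)
    (hL : 0 ≤ L) (hθ : 0 ≤ θ) (hJ : ∀ n, J n → (n : ℝ) ≤ L)
    (hZ : ∀ i ∈ Z, N * marg M B i ≤ L)
    (hLθ : L ^ 2 * Z.card = θ * (2 * Real.exp (-2)) * (N * w)) :
    countMeasure M N B {C | Z ⊆ degreeBin J C ∧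
      (∀ j, J (degree C j) → marg M B j ≤ 2 * Real.exp (-2) * w) ∧
      n₀ ≤ (degreeBin J C).card ∧
      θ * (degreeBin J C).card ≤ ∑ i ∈ Z, ∑ j ∈ degreeBin J C, (C (i, j) : ℝ)} ≤
      ENNReal.ofReal (Real.exp (-(0.1 * (θ * n₀)))) +
        ENNReal.ofReal (Real.exp (-(0.0175 * (θ * n₀)))) := by
  set τ : ℝ := 2 * Real.exp (-2) with hτ
  have hτ0 : 0 ≤ τ := by positivity
  have hτ1 : τ ≤ 0.2707 := two_mul_exp_neg_two_le
  have hNpos : (0 : ℝ) < N := Nat.cast_pos.2 hN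
  have hw := hB.w_pos
  set z : ℝ := (Z.card : ℝ) with hz
  have hz0 : 0 ≤ z := Nat.cast_nonneg _
  set q : ℝ := L * z / (N * w) with hq
  have hq0 : 0 ≤ q := by positivity
  have hLq : L * q = θ * τ := by
    rw [hq]; field_simp; linarith
  have hρZ : ∑ i ∈ Z, marg M B i ≤ q * w := by
    have h1 : ∑ i ∈ Z, N * marg M B i ≤ ∑ _i ∈ Z, L := Finset.sum_le_sum hZ
    rw [← Finset.mul_sum, Finset.sum_const, nsmul_eq_mul] at h1
    have h2 : q * w * N = L * z := by rw [hq]; field_simp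
    refine le_of_mul_le_mul_right ?_ hNpos
    linarith
  have hcol : ∀ j, ∑ i ∈ Z, B i j ≤ q * marg M B j := by
    intro j
    refine le_of_mul_le_mul_right ?_ hw
    calc (∑ i ∈ Z, B i j) * w = ∑ i ∈ Z, B i j * w := Finset.sum_mul _ _ _
      _ ≤ ∑ i ∈ Z, marg M B i * marg M B j := Finset.sum_le_sum fun i _ => hB.le i j
      _ = (∑ i ∈ Z, marg M B i) * marg M B j := (Finset.sum_mul _ _ _).symm
      _ ≤ q * w * marg M B j := mul_le_mul_of_nonneg_right hρZ (hB.marg_nonneg j)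
      _ = q * marg M B j * w := by ring
  have hZZ : N * (∑ e ∈ Z ×ˢ Z, B e.1 e.2) ≤ θ * τ * z := by
    rw [Finset.sum_product_right]
    calc N * ∑ j ∈ Z, ∑ i ∈ Z, B i j ≤ N * ∑ j ∈ Z, q * marg M B j := by
          gcongr with j _; exact hcol j
      _ = q * ∑ j ∈ Z, N * marg M B j := by rw [← Finset.mul_sum, ← Finset.mul_sum]; ring
      _ ≤ q * ∑ _j ∈ Z, L := by gcongr with j hj; exact hZ j hj
      _ = θ * τ * z := by rw [Finset.sum_const, nsmul_eq_mul, ← hLq]; ring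
  have h1 := countMeasure_upper_tail_le (N := N) hB.nonneg (Z ×ˢ Z) _
    (θ * (0.5 * z + 0.1 * n₀)) hZZ
  have h2 := countMeasure_cross_le (N := N) hB Z q L τ (0.0175 * (θ * n₀)) hq0 hcol J hJ hτ0
  have hexp : θ * τ * z * (Real.exp 1 - 1) - θ * (0.5 * z + 0.1 * n₀) ≤ -(0.1 * (θ * n₀)) := by
    have h3 : τ * (Real.exp 1 - 1) ≤ 0.5 := by nlinarith [Real.exp_one_lt_d9]
    have h4 := mul_le_mul_of_nonneg_left h3 (mul_nonneg hθ hz0)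
    linarith
  refine le_trans (measure_mono ?_) ((measure_union_le _ _).trans (add_le_add
    (h1.trans (ENNReal.ofReal_le_ofReal (Real.exp_le_exp.2 hexp))) h2))
  rintro C ⟨hZI, hG, hn, hX⟩
  set I := degreeBin J C with hI
  have hsplit : ∑ i ∈ Z, ∑ j ∈ I, (C (i, j) : ℝ) =
      ∑ e ∈ Z ×ˢ Z, (C e : ℝ) + ∑ j ∈ I \ Z, ∑ i ∈ Z, (C (i, j) : ℝ) := by
    rw [Finset.sum_comm, ← Finset.sum_sdiff hZI, Finset.sum_product_right, add_comm]
  by_cases hcase : θ * (0.5 * z + 0.1 * n₀) ≤ ∑ e ∈ Z ×ˢ Z, (C e : ℝ)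
  · exact Or.inl hcase
  refine Or.inr ⟨hG, ?_⟩
  push Not at hcase
  have hfilter : I \ Z = Zᶜ.filter fun j => J (degree C j) := by
    ext j; simp [hI, degreeBin, and_comm]
  have hcard : ((I \ Z).card : ℝ) = I.card - z := by
    rw [Finset.card_sdiff_of_subset hZI, Nat.cast_sub (Finset.card_le_card hZI)]
  have hzn : z ≤ I.card := Nat.cast_le.2 (Finset.card_le_card hZI)
  rw [← Finset.sum_filter, ← hfilter, Finset.sum_sub_distrib, ← Finset.mul_sum,
    Finset.sum_const, nsmul_eq_mul, hcard, ← mul_assoc L, hLq]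
  rw [hsplit] at hX
  set X := ∑ j ∈ I \ Z, ∑ i ∈ Z, (C (i, j) : ℝ) with hXdef
  set n : ℝ := (I.card : ℝ) with hndef
  have hX' : θ * (0.9 * n - 0.5 * z) ≤ X := by nlinarith
  have hc : 0.2734 ≤ 1 / 2 * (3 / 4) * (1 - τ) := by linarith
  have hX0 : 0 ≤ X := Finset.sum_nonneg fun _ _ => Finset.sum_nonneg fun _ _ => Nat.cast_nonneg _
  have h3 : 0.2734 * X ≤ 1 / 2 * (3 / 4) * (1 - τ) * X := mul_le_mul_of_nonneg_right hc hX0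
  have he := exp_half_sub_one_le
  have he0 : 0 ≤ Real.exp (1 / 2) - 1 := by linarith [Real.add_one_le_exp (1 / 2 : ℝ)]
  have h4 : τ * (Real.exp (1 / 2) - 1) ≤ 0.1757 :=
    (mul_le_mul hτ1 he he0 (by norm_num)).trans (by norm_num)
  have h5 := mul_le_mul_of_nonneg_left h4 (mul_nonneg hθ (sub_nonneg.2 hzn))
  have h6 : θ * z ≤ θ * n := mul_le_mul_of_nonneg_left hzn hθ
  have h7 : θ * n₀ ≤ θ * n := mul_le_mul_of_nonneg_left hn hθ
  have h8 : 0 ≤ θ * z := mul_nonneg hθ hz0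
  nlinarith

lemma choose_le_pow_of_le {M N z : ℕ} (hMN : M ≤ N) (hz : 0 < z) {β : ℝ}
    (hβ : Real.exp 1 * N ≤ β * z) : (M.choose z : ℝ) ≤ β ^ z := by
  have hz' : (0 : ℝ) < z := Nat.cast_pos.2 hz
  have h1 : (M.choose z : ℝ) ≤ (M : ℝ) ^ z / z.factorial := Nat.choose_le_pow_div z M
  have h2 : (z : ℝ) ^ z / z.factorial ≤ Real.exp 1 ^ z := by
    rw [← Real.exp_nat_mul, mul_one]
    exact Real.pow_div_factorial_le_exp _ hz'.le z
  have h3 : (M : ℝ) ^ z ≤ (N : ℝ) ^ z := by gcongr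
  have h4 : (Real.exp 1 * N) ^ z ≤ (β * z) ^ z := by gcongr
  rw [mul_pow, mul_pow] at h4
  refine h1.trans (le_of_mul_le_mul_right ?_ (pow_pos hz' z))
  calc (M : ℝ) ^ z / z.factorial * (z : ℝ) ^ z
      = (M : ℝ) ^ z * ((z : ℝ) ^ z / z.factorial) := by ring
    _ ≤ (N : ℝ) ^ z * Real.exp 1 ^ z := by gcongr
    _ ≤ β ^ z * (z : ℝ) ^ z := by linarith

lemma exp_four_mul_pow_le {u : ℝ} (hu : 54 ≤ u) : Real.exp 4 * u ^ 4 ≤ Real.exp (0.4 * u) := by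
  have h54 : (54 : ℝ) ≤ Real.exp 4 := by
    have : Real.exp 4 = Real.exp 1 ^ 4 := by rw [← Real.exp_nat_mul]; norm_num
    rw [this]
    calc (54 : ℝ) ≤ 2.718 ^ 4 := by norm_num
      _ ≤ _ := by gcongr; linarith [Real.exp_one_gt_d9]
  have h1 : u ≤ Real.exp (u / 54 + 3) := by
    have h2 := Real.add_one_le_exp (u / 54 - 1)
    calc u = 54 * (u / 54 - 1 + 1) := by ring
      _ ≤ Real.exp 4 * Real.exp (u / 54 - 1) := by
        have : 0 ≤ u / 54 - 1 + 1 := by linarith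
        gcongr
      _ = _ := by rw [← Real.exp_add]; ring_nf
  calc Real.exp 4 * u ^ 4 ≤ Real.exp 4 * Real.exp (u / 54 + 3) ^ 4 := by gcongr
    _ = Real.exp (4 + 4 * (u / 54 + 3)) := by
      rw [← Real.exp_nat_mul, ← Real.exp_add]; norm_num
    _ ≤ _ := Real.exp_le_exp.2 (by linarith)

lemma exp_neg_le_of_sq_le {v x : ℝ} (hv : 0 ≤ v) (hx : 0 < x) (h : x ≤ v ^ 2) :
    Real.exp (-v) ≤ 720 / x ^ 3 := by
  have h1 := Real.pow_div_factorial_le_exp v hv 6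
  have h2 : x ^ 3 ≤ v ^ 6 := by
    calc x ^ 3 ≤ (v ^ 2) ^ 3 := by gcongr
      _ = v ^ 6 := by ring
  rw [Real.exp_neg, inv_le_comm₀ (Real.exp_pos _) (by positivity), inv_div]
  refine le_trans ?_ h1
  norm_num [Nat.factorial]
  gcongr

lemma exp_neg_le_of_pow_four_le {v x : ℝ} (hv : 0 ≤ v) (hx : 0 < x) (h : x ≤ v ^ 4) :
    Real.exp (-v) ≤ 40320 / x ^ 2 := by
  have h1 := Real.pow_div_factorial_le_exp v hv 8
  have h2 : x ^ 2 ≤ v ^ 8 := by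
    calc x ^ 2 ≤ (v ^ 4) ^ 2 := by gcongr
      _ = v ^ 8 := by ring
  rw [Real.exp_neg, inv_le_comm₀ (Real.exp_pos _) (by positivity), inv_div]
  refine le_trans ?_ h1
  norm_num [Nat.factorial]
  gcongr

/-- A large set covered by three subsets meets one of them in a set of prescribed size. -/
lemma exists_subset_card_of_cover {α : Type*} [DecidableEq α] {S A₁ A₂ A₃ : Finset α} {z : ℕ}
    {x : ℝ} (hS : S ⊆ A₁ ∪ A₂ ∪ A₃) (hx : x ≤ S.card) (hz : z = ⌈x / 3⌉₊) :
    ∃ Z : Finset α, Z.card = z ∧ (Z ⊆ A₁ ∨ Z ⊆ A₂ ∨ Z ⊆ A₃) := by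
  by_contra! h
  have hlt : ∀ A : Finset α, (∀ Z : Finset α, Z.card = z → ¬ Z ⊆ A) → (A.card : ℝ) < x / 3 := by
    intro A hA
    by_contra! hc
    obtain ⟨Z, hZA, hZ⟩ := Finset.exists_subset_card_eq (n := z) (s := A)
      (by rw [hz]; exact Nat.ceil_le.2 hc)
    exact hA Z hZ hZA
  have h1 := hlt A₁ fun Z hZ => (h Z hZ).1
  have h2 := hlt A₂ fun Z hZ => (h Z hZ).2.1
  have h3 := hlt A₃ fun Z hZ => (h Z hZ).2.2
  have h4 : S.card ≤ A₁.card + A₂.card + A₃.card :=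
    (Finset.card_le_card hS).trans ((Finset.card_union_le _ _).trans
      (Nat.add_le_add_right (Finset.card_union_le _ _) _))
  have h5 : (S.card : ℝ) ≤ A₁.card + A₂.card + A₃.card := by exact_mod_cast h4
  linarith

/-- The words of the bin whose row or column within the block of the bin has sum above `T`. -/
def heavyWords {M : ℕ} (J : ℕ → Prop) (T : ℝ) (C : Fin M × Fin M → ℕ) : Finset (Fin M) :=
  (degreeBin J C).filter fun i =>
    T < ∑ j ∈ degreeBin J C, (C (i, j) : ℝ) ∨ T < ∑ j ∈ degreeBin J C, (C (j, i) : ℝ)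

lemma sum_row_add_sum_col_eq_degree {M : ℕ} (C : Fin M × Fin M → ℕ) (i : Fin M) :
    (∑ j, (C (i, j) : ℝ)) + ∑ j, (C (j, i) : ℝ) = degree C i := by
  simp [degree, Finset.sum_add_distrib]

lemma sum_row_le_degree {M : ℕ} (C : Fin M × Fin M → ℕ) (i : Fin M) (I : Finset (Fin M)) :
    ∑ j ∈ I, (C (i, j) : ℝ) ≤ degree C i := by
  have h1 : ∑ j ∈ I, (C (i, j) : ℝ) ≤ ∑ j, (C (i, j) : ℝ) :=
    Finset.sum_le_sum_of_subset_of_nonneg (Finset.subset_univ _) fun _ _ _ => Nat.cast_nonneg _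
  have h2 : 0 ≤ ∑ j, (C (j, i) : ℝ) := Finset.sum_nonneg fun _ _ => Nat.cast_nonneg _
  linarith [sum_row_add_sum_col_eq_degree C i]

lemma degree_comp_swap {M : ℕ} (C : Fin M × Fin M → ℕ) (i : Fin M) :
    degree (C ∘ Prod.swap) i = degree C i := by
  simp only [degree, Function.comp, Prod.swap]
  exact Finset.sum_congr rfl fun j _ => add_comm _ _

lemma sum_col_le_degree {M : ℕ} (C : Fin M × Fin M → ℕ) (i : Fin M) (I : Finset (Fin M)) :
    ∑ j ∈ I, (C (j, i) : ℝ) ≤ degree C i := by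
  rw [← degree_comp_swap]
  exact sum_row_le_degree (C ∘ Prod.swap) i I

lemma degreeBin_comp_swap {M : ℕ} (J : ℕ → Prop) (C : Fin M × Fin M → ℕ) :
    degreeBin J (C ∘ Prod.swap) = degreeBin J C := by
  simp only [degreeBin, degree_comp_swap]

/-- A nonempty set of heavy words forces the bin to be neither too low nor too high. -/
lemma bounds_of_mem_heavyWords {M N : ℕ} (hN : 0 < N) {w a : ℝ} (hw : 0 < w) (ha : 0 < a)
    {J : ℕ → Prop} (hJ : ∀ n, J n → (n : ℝ) < 2 * a ^ 2 / Real.exp 1)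
    {C : Fin M × Fin M → ℕ} (hI : 20 * N / a ^ 3 ≤ (degreeBin J C).card) {i : Fin M}
    (hi : i ∈ heavyWords J (2 * a ^ 4 / (N * w) * (degreeBin J C).card) C) :
    20 * Real.exp 1 < a * w ∧ a ^ 2 * Real.exp 1 ≤ N * w := by
  have hN' : (0 : ℝ) < N := Nat.cast_pos.2 hN
  have he := Real.exp_pos 1
  simp only [heavyWords, Finset.mem_filter] at hi
  obtain ⟨hiI, hi⟩ := hi
  have hn1 : (1 : ℝ) ≤ (degreeBin J C).card := Nat.one_le_cast.2 (Finset.card_pos.2 ⟨i, hiI⟩)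
  have hd : (degree C i : ℝ) < 2 * a ^ 2 / Real.exp 1 :=
    hJ _ (Finset.mem_filter.1 hiI).2
  have hT : 2 * a ^ 4 / (N * w) * (degreeBin J C).card < 2 * a ^ 2 / Real.exp 1 := by
    rcases hi with hi | hi
    · exact (hi.trans_le (sum_row_le_degree C i _)).trans hd
    · exact (hi.trans_le (sum_col_le_degree C i _)).trans hd
  set n : ℝ := ((degreeBin J C).card : ℝ)
  have h1 : a ^ 2 * n * Real.exp 1 < N * w := by
    rw [lt_div_iff₀ he, div_mul_eq_mul_div, div_mul_eq_mul_div, div_lt_iff₀ (by positivity)] at hT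
    have h3 : 0 < 2 * a ^ 2 := by positivity
    refine lt_of_mul_lt_mul_left ?_ h3.le
    nlinarith
  constructor
  · rw [div_le_iff₀ (by positivity)] at hI
    refine lt_of_mul_lt_mul_left ?_ hN'.le
    calc N * (20 * Real.exp 1) = (20 * N) * Real.exp 1 := by ring
      _ ≤ (n * a ^ 3) * Real.exp 1 := by gcongr
      _ = a * (a ^ 2 * n * Real.exp 1) := by ring
      _ < a * (N * w) := by gcongr
      _ = N * (a * w) := by ring
  · refine le_trans ?_ h1.le
    gcongr
    nlinarith [sq_nonneg a]

/-- With high probability, words of large marginal do not fall in a low bin. -/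
lemma countMeasure_exists_degree_lt_le {M N : ℕ} (hMN : M ≤ N) {B : Matrix (Fin M) (Fin M) ℝ}
    {w : ℝ} (hB : MargDominated M B w) (σ L : ℝ) (hσ : 0 ≤ σ) (hL : L ≤ N * σ) :
    countMeasure M N B {C | ∃ j, σ < marg M B j ∧ (degree C j : ℝ) < L} ≤
      ENNReal.ofReal (2 * N * Real.exp (-(3 / 20 * (N * σ)))) := by
  have hsub : {C : Fin M × Fin M → ℕ | ∃ j, σ < marg M B j ∧ (degree C j : ℝ) < L} ⊆
      ⋃ j ∈ (Finset.univ : Finset (Fin M)),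
        {C | σ < marg M B j ∧ (degree C j : ℝ) < L} := by
    rintro C ⟨j, hj⟩
    simp only [Finset.mem_univ, Set.iUnion_true, Set.mem_iUnion]
    exact ⟨j, hj⟩
  have hterm : ∀ j : Fin M, countMeasure M N B {C | σ < marg M B j ∧ (degree C j : ℝ) < L} ≤
      2 * ENNReal.ofReal (Real.exp (-(3 / 20 * (N * σ)))) := by
    intro j
    by_cases hj : σ < marg M B j
    · refine le_trans (measure_mono ?_) (countMeasure_sum_degree_lt_le (N := N) hB {j} (N * σ)
        (mul_nonneg N.cast_nonneg hσ) (by rw [Finset.sum_singleton]; gcongr))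
      rintro C ⟨-, hC⟩
      simpa using hC.trans_le hL
    · simp [hj]
  refine (measure_mono hsub).trans ((measure_biUnion_finset_le _ _).trans ?_)
  refine (Finset.sum_le_sum fun j _ => hterm j).trans ?_
  rw [Finset.sum_const, Finset.card_univ, Fintype.card_fin, nsmul_eq_mul,
    ENNReal.ofReal_mul (by positivity), ENNReal.ofReal_mul (by norm_num), ENNReal.ofReal_natCast,
    ← mul_assoc, show ENNReal.ofReal 2 = 2 by norm_num, mul_comm 2 (N : ℝ≥0∞)]
  gcongr

/-- The bound on the probability that a prescribed set of words is entirely made of heavy rows,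
of heavy columns, or of words of too small degree. -/
lemma countMeasure_heavy_subset_le {M N : ℕ} (hN : 0 < N) {B : Matrix (Fin M) (Fin M) ℝ} {w a : ℝ}
    (hB : MargDominated M B w) (ha : 0 < a) (haw : 20 * Real.exp 1 < a * w)
    {J : ℕ → Prop} (hJ : ∀ n, J n → (n : ℝ) < 2 * a ^ 2 / Real.exp 1)
    (Z : Finset (Fin M)) (hZ : 0 < Z.card) :
    countMeasure M N B {C | Z ⊆ degreeBin J C ∧
      (∀ j, J (degree C j) → marg M B j ≤ 2 * Real.exp (-2) * w) ∧
      20 * N / a ^ 3 ≤ (degreeBin J C).card ∧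
      ((∀ i ∈ Z, 2 * a ^ 2 / Real.exp 1 < N * marg M B i) ∨
        (∀ i ∈ Z, N * marg M B i ≤ 2 * a ^ 2 / Real.exp 1) ∧
          ((∀ i ∈ Z, 2 * a ^ 4 / (N * w) * (degreeBin J C).card <
              ∑ j ∈ degreeBin J C, (C (i, j) : ℝ)) ∨
            ∀ i ∈ Z, 2 * a ^ 4 / (N * w) * (degreeBin J C).card <
              ∑ j ∈ degreeBin J C, (C (j, i) : ℝ)))} ≤
      ENNReal.ofReal (6 * Real.exp (-(0.7 * (Z.card * (a / w))))) := by
  have hN' : (0 : ℝ) < N := Nat.cast_pos.2 hN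
  have hw := hB.w_pos
  have he := Real.exp_pos 1
  set L : ℝ := 2 * a ^ 2 / Real.exp 1 with hLdef
  set s : ℝ := 2 * a ^ 4 / (N * w) with hs
  set z : ℝ := (Z.card : ℝ) with hz
  have hz0 : 0 < z := Nat.cast_pos.2 hZ
  have hL0 : 0 < L := by positivity
  set v : ℝ := z * (a / w) with hv
  have hv0 : 0 < v := by positivity
  have hLz : 40 * v ≤ L * z := by
    have : 40 * (a / w) ≤ L := by
      rw [hLdef, ← mul_div_assoc, div_le_div_iff₀ hw he]
      nlinarith
    calc 40 * v = 40 * (a / w) * z := by rw [hv]; ring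
      _ ≤ L * z := by gcongr
  set E : ℝ := Real.exp (-(0.7 * v)) with hE
  have hbad : countMeasure M N B {C | (∀ i ∈ Z, L < N * marg M B i) ∧
      ∑ i ∈ Z, (degree C i : ℝ) < L * z} ≤ ENNReal.ofReal (2 * E) := by
    by_cases hall : ∀ i ∈ Z, L < N * marg M B i
    · have h1 := countMeasure_sum_degree_lt_le (N := N) hB Z (L * z) (by positivity) (by
        rw [Finset.mul_sum]
        calc L * z = ∑ _i ∈ Z, L := by rw [Finset.sum_const, nsmul_eq_mul, mul_comm]
          _ ≤ _ := Finset.sum_le_sum fun i hi => (hall i hi).le)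
      refine (measure_mono fun C hC => hC.2).trans (h1.trans ?_)
      rw [ENNReal.ofReal_mul (by norm_num), show ENNReal.ofReal 2 = 2 by norm_num]
      gcongr
      rw [hE]
      exact Real.exp_le_exp.2 (by linarith)
    · have : {C : Fin M × Fin M → ℕ | (∀ i ∈ Z, L < N * marg M B i) ∧
          ∑ i ∈ Z, (degree C i : ℝ) < L * z} = ∅ := by
        ext C; simp only [Set.mem_ofPred_eq, Set.mem_empty_iff_false, iff_false]
        exact fun h => hall h.1
      rw [this, measure_empty]
      exact zero_le
  set G : Set (Fin M × Fin M → ℕ) := {C | (∀ i ∈ Z, N * marg M B i ≤ L) ∧ Z ⊆ degreeBin J C ∧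
      (∀ j, J (degree C j) → marg M B j ≤ 2 * Real.exp (-2) * w) ∧
      20 * N / a ^ 3 ≤ (degreeBin J C).card ∧
      (z * s) * (degreeBin J C).card ≤ ∑ i ∈ Z, ∑ j ∈ degreeBin J C, (C (i, j) : ℝ)} with hG
  have hrow : countMeasure M N B G ≤ ENNReal.ofReal (2 * E) := by
    by_cases hall : ∀ i ∈ Z, N * marg M B i ≤ L
    · have hexp2 : Real.exp (-2) = 1 / (Real.exp 1) ^ 2 := by
        rw [Real.exp_neg, ← Real.exp_nat_mul, one_div]; norm_num
      have hθ : z * s * (20 * N / a ^ 3) = 40 * v := by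
        rw [hs, hv]; field_simp; ring
      have h1 := countMeasure_heavy_rows_le hN hB Z J L (z * s) (20 * N / a ^ 3) hL0.le
        (by positivity) (fun n hn => (hJ n hn).le) hall
        (by rw [hexp2, hs, hLdef]; field_simp; ring)
      refine (measure_mono fun C hC => hC.2).trans (h1.trans ?_)
      rw [← ENNReal.ofReal_add (by positivity) (by positivity), hθ]
      refine ENNReal.ofReal_le_ofReal ?_
      have h2 : Real.exp (-(0.1 * (40 * v))) ≤ E := Real.exp_le_exp.2 (by linarith)
      have h3 : Real.exp (-(0.0175 * (40 * v))) ≤ E := Real.exp_le_exp.2 (by linarith)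
      linarith
    · have : G = ∅ := by
        ext C; simp only [hG, Set.mem_ofPred_eq, Set.mem_empty_iff_false, iff_false]
        exact fun h => hall h.1
      rw [this, measure_empty]
      exact zero_le
  have hcol : countMeasure M N B ((fun C => C ∘ Prod.swap) ⁻¹' G) ≤ ENNReal.ofReal (2 * E) := by
    rw [countMeasure_preimage_swap hB.symm]; exact hrow
  have h6 : ENNReal.ofReal (6 * E) =
      ENNReal.ofReal (2 * E) + (ENNReal.ofReal (2 * E) + ENNReal.ofReal (2 * E)) := by
    rw [← ENNReal.ofReal_add (by positivity) (by positivity),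
      ← ENNReal.ofReal_add (by positivity) (by positivity)]
    congr 1; ring
  rw [h6]
  refine le_trans (measure_mono ?_) ((measure_union_le _ _).trans (add_le_add hbad
    ((measure_union_le _ _).trans (add_le_add hrow hcol))))
  have hsum : ∀ (f : Fin M → ℝ) (T : ℝ), (∀ i ∈ Z, T < f i) → z * T ≤ ∑ i ∈ Z, f i := by
    intro f T h
    calc z * T = ∑ _i ∈ Z, T := by rw [Finset.sum_const, nsmul_eq_mul]
      _ ≤ _ := Finset.sum_le_sum fun i hi => (h i hi).le
  rintro C ⟨hZI, hC, hn, hcase⟩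
  rcases hcase with hcase | ⟨hgood, hcase | hcase⟩
  · refine Or.inl ⟨hcase, ?_⟩
    calc ∑ i ∈ Z, (degree C i : ℝ) < ∑ _i ∈ Z, L :=
          Finset.sum_lt_sum_of_nonempty (Finset.card_pos.1 hZ) fun i hi =>
            hJ _ (Finset.mem_filter.1 (hZI hi)).2
      _ = L * z := by rw [Finset.sum_const, nsmul_eq_mul, mul_comm]
  · refine Or.inr (Or.inl ⟨hgood, hZI, hC, hn, ?_⟩)
    rw [mul_assoc]
    exact hsum _ _ hcase
  · refine Or.inr (Or.inr ?_)
    simp only [Set.mem_preimage, hG, Set.mem_ofPred_eq, degreeBin_comp_swap, degree_comp_swap]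
    refine ⟨hgood, hZI, hC, hn, ?_⟩
    rw [mul_assoc]
    exact hsum _ _ hcase

/-- With high probability a large bin has few heavy words. -/
lemma countMeasure_many_heavyWords_le {M N : ℕ} (hN : 0 < N) (hMN : M ≤ N)
    {B : Matrix (Fin M) (Fin M) ℝ} {w a : ℝ} (hB : MargDominated M B w) (hw1 : w ≤ 1) (ha : 0 < a)
    {J : ℕ → Prop} (hJ : ∀ n, J n → (n : ℝ) < 2 * a ^ 2 / Real.exp 1) :
    countMeasure M N B {C | 20 * N / a ^ 3 ≤ (degreeBin J C).card ∧
      5 / 16 * (w * N / a ^ 4) ≤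
        (heavyWords J (2 * a ^ 4 / (N * w) * (degreeBin J C).card) C).card} ≤
      ENNReal.ofReal (10 ^ 12 / N ^ 2) := by
  have hN' : (0 : ℝ) < N := Nat.cast_pos.2 hN
  have hw := hB.w_pos
  have he := Real.exp_pos 1
  have he' := Real.exp_one_gt_d9
  set x : ℝ := 5 / 16 * (w * N / a ^ 4) with hx
  have hx0 : 0 < x := by positivity
  set E : Set (Fin M × Fin M → ℕ) := {C | 20 * N / a ^ 3 ≤ (degreeBin J C).card ∧
      x ≤ (heavyWords J (2 * a ^ 4 / (N * w) * (degreeBin J C).card) C).card} with hE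
  by_cases hH : 20 * Real.exp 1 < a * w ∧ a ^ 2 * Real.exp 1 ≤ N * w
  swap
  · have : E = ∅ := by
      ext C
      simp only [hE, Set.mem_ofPred_eq, Set.mem_empty_iff_false, iff_false]
      rintro ⟨h1, h2⟩
      obtain ⟨i, hi⟩ := Finset.card_pos.1 (Nat.cast_pos.1 (hx0.trans_le h2))
      exact hH (bounds_of_mem_heavyWords hN hw ha hJ h1 hi)
    rw [this, measure_empty]
    exact zero_le
  obtain ⟨haw, haN⟩ := hH
  have ha54 : 54 ≤ a := by nlinarith
  set z : ℕ := ⌈x / 3⌉₊ with hz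
  have hz0 : 0 < z := Nat.ceil_pos.2 (by positivity)
  have hz1 : (1 : ℝ) ≤ z := Nat.one_le_cast.2 hz0
  have hzx : x / 3 ≤ z := Nat.le_ceil _
  set u : ℝ := a / w with hu
  have hau : a ≤ u := by rw [hu, le_div_iff₀ hw]; nlinarith
  have hu54 : 54 ≤ u := ha54.trans hau
  set σ : ℝ := 2 * Real.exp (-2) * w with hσ
  have hσ0 : 0 ≤ σ := by positivity
  have hexp2 : Real.exp (-2) = 1 / (Real.exp 1) ^ 2 := by
    rw [Real.exp_neg, ← Real.exp_nat_mul, one_div]; norm_num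
  have hLσ : 2 * a ^ 2 / Real.exp 1 ≤ N * σ := by
    rw [hσ, hexp2]
    calc 2 * a ^ 2 / Real.exp 1 = 2 * (a ^ 2 * Real.exp 1) / Real.exp 1 ^ 2 := by field_simp
      _ ≤ 2 * (N * w) / Real.exp 1 ^ 2 := by gcongr
      _ = _ := by ring
  set Ev : Finset (Fin M) → Set (Fin M × Fin M → ℕ) := fun Z => {C | Z ⊆ degreeBin J C ∧
      (∀ j, J (degree C j) → marg M B j ≤ 2 * Real.exp (-2) * w) ∧
      20 * N / a ^ 3 ≤ (degreeBin J C).card ∧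
      ((∀ i ∈ Z, 2 * a ^ 2 / Real.exp 1 < N * marg M B i) ∨
        (∀ i ∈ Z, N * marg M B i ≤ 2 * a ^ 2 / Real.exp 1) ∧
          ((∀ i ∈ Z, 2 * a ^ 4 / (N * w) * (degreeBin J C).card <
              ∑ j ∈ degreeBin J C, (C (i, j) : ℝ)) ∨
            ∀ i ∈ Z, 2 * a ^ 4 / (N * w) * (degreeBin J C).card <
              ∑ j ∈ degreeBin J C, (C (j, i) : ℝ)))} with hEv
  have hsub : E ⊆ {C | ∃ j, σ < marg M B j ∧ (degree C j : ℝ) < 2 * a ^ 2 / Real.exp 1} ∪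
      ⋃ Z ∈ Finset.powersetCard z Finset.univ, Ev Z := by
    rintro C ⟨h1, h2⟩
    by_cases hG : ∀ j, J (degree C j) → marg M B j ≤ σ
    swap
    · push Not at hG
      obtain ⟨j, hj, hj'⟩ := hG
      exact Or.inl ⟨j, hj', hJ _ hj⟩
    right
    set T : ℝ := 2 * a ^ 4 / (N * w) * (degreeBin J C).card with hT
    set S := heavyWords J T C with hS
    obtain ⟨Z, hZc, hZ⟩ := exists_subset_card_of_cover (S := S)
      (A₁ := S.filter fun i => 2 * a ^ 2 / Real.exp 1 < N * marg M B i)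
      (A₂ := S.filter fun i => N * marg M B i ≤ 2 * a ^ 2 / Real.exp 1 ∧
        T < ∑ j ∈ degreeBin J C, (C (i, j) : ℝ))
      (A₃ := S.filter fun i => N * marg M B i ≤ 2 * a ^ 2 / Real.exp 1 ∧
        T < ∑ j ∈ degreeBin J C, (C (j, i) : ℝ)) (x := x) (z := z) (by
        intro i hi
        have hi' := (Finset.mem_filter.1 hi).2
        simp only [Finset.mem_union, Finset.mem_filter, hi, true_and]
        rcases le_or_gt (N * marg M B i) (2 * a ^ 2 / Real.exp 1) with hc | hc
        · rcases hi' with hi' | hi'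
          · exact Or.inl (Or.inr ⟨hc, hi'⟩)
          · exact Or.inr ⟨hc, hi'⟩
        · exact Or.inl (Or.inl hc)) h2 rfl
    have hSI : S ⊆ degreeBin J C := Finset.filter_subset _ _
    simp only [Set.mem_iUnion, Finset.mem_powersetCard, Finset.subset_univ, true_and]
    refine ⟨Z, hZc, ?_⟩
    rcases hZ with hZ | hZ | hZ
    · exact ⟨hZ.trans ((Finset.filter_subset _ _).trans hSI), hG, h1,
        Or.inl fun i hi => (Finset.mem_filter.1 (hZ hi)).2⟩
    · exact ⟨hZ.trans ((Finset.filter_subset _ _).trans hSI), hG, h1,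
        Or.inr ⟨fun i hi => (Finset.mem_filter.1 (hZ hi)).2.1,
          Or.inl fun i hi => (Finset.mem_filter.1 (hZ hi)).2.2⟩⟩
    · exact ⟨hZ.trans ((Finset.filter_subset _ _).trans hSI), hG, h1,
        Or.inr ⟨fun i hi => (Finset.mem_filter.1 (hZ hi)).2.1,
          Or.inr fun i hi => (Finset.mem_filter.1 (hZ hi)).2.2⟩⟩
  have hdeg := countMeasure_exists_degree_lt_le hMN hB σ (2 * a ^ 2 / Real.exp 1) hσ0 hLσ
  have hunion : countMeasure M N B (⋃ Z ∈ Finset.powersetCard z Finset.univ, Ev Z) ≤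
      ENNReal.ofReal (6 * Real.exp (-(0.3 * (z * u)))) := by
    refine (measure_biUnion_finset_le _ _).trans ?_
    refine (Finset.sum_le_sum (g := fun _ =>
      ENNReal.ofReal (6 * Real.exp (-(0.7 * (z * u))))) fun Z hZ => ?_).trans ?_
    · have hZc := (Finset.mem_powersetCard.1 hZ).2
      have := countMeasure_heavy_subset_le hN hB ha haw hJ Z (hZc ▸ hz0)
      rw [hZc] at this
      exact this
    · rw [Finset.sum_const, Finset.card_powersetCard, Finset.card_univ, Fintype.card_fin,
        nsmul_eq_mul, ← ENNReal.ofReal_natCast, ← ENNReal.ofReal_mul (Nat.cast_nonneg _)]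
      refine ENNReal.ofReal_le_ofReal ?_
      have hβ : Real.exp 1 * N ≤ Real.exp 4 * u ^ 4 * z := by
        have h1 : Real.exp 4 = Real.exp 1 * Real.exp 1 ^ 3 := by
          rw [← Real.exp_nat_mul, ← Real.exp_add]; norm_num
        have h2 : (9.6 : ℝ) ≤ Real.exp 1 ^ 3 := by
          calc (9.6 : ℝ) ≤ 2.7 ^ 3 := by norm_num
            _ ≤ _ := by gcongr; linarith
        have h3 : N ≤ 9.6 * (u ^ 4 * (x / 3)) := by
          have h4 : 9.6 * (u ^ 4 * (x / 3)) = N * (1 / w ^ 3) := by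
            rw [hx, hu]; field_simp; norm_num
          rw [h4]
          refine le_mul_of_one_le_right hN'.le ?_
          rw [one_le_div (by positivity)]
          exact pow_le_one₀ hw.le hw1
        rw [h1, mul_assoc, mul_assoc]
        refine mul_le_mul_of_nonneg_left (h3.trans ?_) he.le
        gcongr
      have hch := choose_le_pow_of_le hMN hz0 hβ
      calc (M.choose z : ℝ) * (6 * Real.exp (-(0.7 * (z * u))))
          ≤ Real.exp (0.4 * u) ^ z * (6 * Real.exp (-(0.7 * (z * u)))) := by
            gcongr
            exact hch.trans (by gcongr; exact exp_four_mul_pow_le hu54)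
        _ = 6 * (Real.exp (z * (0.4 * u)) * Real.exp (-(0.7 * (z * u)))) := by
            rw [Real.exp_nat_mul]; ring
        _ = 6 * Real.exp (-(0.3 * (z * u))) := by
            rw [← Real.exp_add]; congr 2; ring
  refine (measure_mono hsub).trans ((measure_union_le _ _).trans
    ((add_le_add hdeg hunion).trans ?_))
  rw [← ENNReal.ofReal_add (by positivity) (by positivity)]
  refine ENNReal.ofReal_le_ofReal ?_
  have hb1 : Real.exp (-(3 / 20 * (N * σ))) ≤ 720 / N ^ 3 := by
    refine exp_neg_le_of_sq_le (by positivity) hN' ?_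
    have h1 : 1000 * N ≤ (N * w) ^ 2 := by
      calc 1000 * (N : ℝ) ≤ N * ((20 * 1) * (54 * 1)) := by linarith
        _ ≤ N * ((20 * Real.exp 1) * (54 * Real.exp 1)) := by gcongr <;> linarith
        _ ≤ N * ((a * w) * (a * Real.exp 1)) := by gcongr
        _ = (N * w) * (a ^ 2 * Real.exp 1) := by ring
        _ ≤ (N * w) * (N * w) := by gcongr
        _ = _ := by ring
    have h2 : 0.04 ≤ 3 / 20 * (2 * Real.exp (-2)) := by
      rw [hexp2, mul_one_div, ← mul_div_assoc, le_div_iff₀ (by positivity)]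
      have := Real.exp_one_lt_d9
      nlinarith
    calc (N : ℝ) ≤ 0.04 ^ 2 * (1000 * N) := by linarith
      _ ≤ 0.04 ^ 2 * (N * w) ^ 2 := by gcongr
      _ = (0.04 * (N * w)) ^ 2 := by ring
      _ ≤ (3 / 20 * (2 * Real.exp (-2)) * (N * w)) ^ 2 := by gcongr
      _ = _ := by rw [hσ]; ring
  have hb2 : Real.exp (-(0.3 * (z * u))) ≤ 40320 / ((8 / 10000) * N) ^ 2 := by
    refine exp_neg_le_of_pow_four_le (by positivity) (by positivity) ?_
    have h1 : (5 / 48) * N ≤ z * u ^ 4 := by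
      have h4 : (x / 3) * u ^ 4 = (5 / 48) * N * (1 / w ^ 3) := by
        rw [hx, hu]; field_simp; norm_num
      calc (5 / 48) * (N : ℝ) ≤ (5 / 48) * N * (1 / w ^ 3) := by
            refine le_mul_of_one_le_right (by positivity) ?_
            rw [one_le_div (by positivity)]
            exact pow_le_one₀ hw.le hw1
        _ ≤ _ := by rw [← h4]; gcongr
    have h2 : (z : ℝ) ≤ z ^ 4 := le_self_pow₀ hz1 (by norm_num)
    calc 8 / 10000 * (N : ℝ) ≤ 0.3 ^ 4 * ((5 / 48) * N) := by linarith
      _ ≤ 0.3 ^ 4 * (z ^ 4 * u ^ 4) := by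
        refine mul_le_mul_of_nonneg_left (h1.trans ?_) (by norm_num)
        gcongr
      _ = _ := by ring
  calc 2 * N * Real.exp (-(3 / 20 * (N * σ))) + 6 * Real.exp (-(0.3 * (z * u)))
      ≤ 2 * N * (720 / N ^ 3) + 6 * (40320 / ((8 / 10000) * N) ^ 2) := by gcongr
    _ = (1440 + 6 * 40320 * (10000 / 8) ^ 2) / N ^ 2 := by field_simp; norm_num
    _ ≤ 10 ^ 12 / N ^ 2 := by gcongr; norm_num

lemma margDominated_mul_mul_transpose {M R : ℕ} {P : Matrix (Fin M) (Fin R) ℝ}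
    {W : Matrix (Fin R) (Fin R) ℝ} {w : ℝ} (hw : 0 < w) (hP : ∀ i r, 0 ≤ P i r)
    (hP1 : ∀ r, ∑ i, P i r = 1) (hWs : ∀ s t, W s t = W t s) (hW : ∀ s t, 0 ≤ W s t)
    (hWw : ∀ s, w ≤ ∑ t, W s t) : MargDominated M (P * W * Pᵀ) w := by
  have hB : ∀ i j, (P * W * Pᵀ) i j = ∑ s, ∑ t, P i s * W s t * P j t := by
    intro i j
    simp only [Matrix.mul_apply, Matrix.transpose_apply, Finset.sum_mul]
    exact Finset.sum_comm
  have hmarg : ∀ i, marg M (P * W * Pᵀ) i = ∑ s, P i s * ∑ t, W s t := by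
    intro i
    simp only [marg, hB]
    rw [Finset.sum_comm]
    refine Finset.sum_congr rfl fun s _ => ?_
    rw [Finset.sum_comm, Finset.mul_sum]
    refine Finset.sum_congr rfl fun t _ => ?_
    rw [← Finset.mul_sum, hP1, mul_one]
  refine ⟨fun i j => ?_, fun i j => ?_, hw, fun i j => ?_⟩
  · rw [hB]
    exact Finset.sum_nonneg fun s _ => Finset.sum_nonneg fun t _ =>
      mul_nonneg (mul_nonneg (hP i s) (hW s t)) (hP j t)
  · rw [hB, hB, Finset.sum_comm]
    refine Finset.sum_congr rfl fun s _ => Finset.sum_congr rfl fun t _ => ?_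
    rw [hWs t s]; ring
  · rw [hB, hmarg, hmarg, Finset.sum_mul_sum, Finset.sum_mul]
    refine Finset.sum_le_sum fun s _ => ?_
    rw [Finset.sum_mul]
    refine Finset.sum_le_sum fun t _ => ?_
    have h1 : W s t ≤ ∑ t, W s t :=
      Finset.single_le_sum (fun t _ => hW s t) (Finset.mem_univ t)
    have h2 : W s t * w ≤ (∑ t, W s t) * ∑ r, W t r :=
      mul_le_mul h1 (hWw t) hw.le ((hW s t).trans h1)
    calc P i s * W s t * P j t * w = (P i s * P j t) * (W s t * w) := by ring
      _ ≤ (P i s * P j t) * ((∑ t, W s t) * ∑ r, W t r) :=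
          mul_le_mul_of_nonneg_left h2 (mul_nonneg (hP i s) (hP j t))
      _ = _ := by ring

/-- The degree range that defines the `k`-th bin. -/
def binRange (k n : ℕ) : Prop :=
  2 * Real.exp ((k : ℝ) - 1) ≤ n ∧ (n : ℝ) < 2 * Real.exp k

lemma binSet_eq_degreeBin {M N : ℕ} (hN : 0 < N) (C : Fin M × Fin M → ℕ) (k : ℕ) :
    binSet M N C k = degreeBin (binRange k) C := by
  have hN' : (0 : ℝ) < N := Nat.cast_pos.2 hN
  ext i
  have h : empMarg M N C i = (degree C i / 2 : ℝ) / N := by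
    rw [empMarg, degree, div_div]; push_cast; rfl
  simp only [binSet, degreeBin, Finset.mem_filter, Finset.mem_univ, true_and, h]
  rw [binRange, div_le_div_iff_of_pos_right hN', div_lt_div_iff_of_pos_right hN', le_div_iff₀ two_pos,
    div_lt_iff₀ two_pos, mul_comm _ (2 : ℝ), mul_comm _ (2 : ℝ)]

lemma zeroedSet_subset_heavyWords {M N : ℕ} (hN : 0 < N) {w : ℝ} (hw : 0 < w)
    (C : Fin M × Fin M → ℕ) (k : ℕ) :
    zeroedSet M N w C C k ⊆ heavyWords (binRange k)
      (2 * Real.exp (((k : ℝ) + 1) / 2) ^ 4 / (N * w) * (degreeBin (binRange k) C).card) C := by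
  have hN' : (0 : ℝ) < N := Nat.cast_pos.2 hN
  intro i hi
  simp only [zeroedSet, binSet_eq_degreeBin hN, Finset.mem_filter] at hi
  obtain ⟨hiI, hi⟩ := hi
  have hd : (degree C i : ℝ) < 2 * Real.exp k := (Finset.mem_filter.1 hiI).2.2
  have hfull : ∀ y : ℝ, y ≤ degree C i → ¬ 2 * binThresh N k < y / N := by
    intro y hy h
    rw [binThresh, ← mul_div_assoc, div_lt_div_iff_of_pos_right hN'] at h
    have : Real.exp (k : ℝ) ≤ Real.exp ((k : ℝ) + 1) := Real.exp_le_exp.2 (by linarith)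
    linarith
  have hT : 2 * ((degreeBin (binRange k) C).card : ℝ) * binThresh N k ^ 2 / w =
      2 * Real.exp (((k : ℝ) + 1) / 2) ^ 4 / (N * w) * (degreeBin (binRange k) C).card / N := by
    have : Real.exp ((k : ℝ) + 1) = Real.exp (((k : ℝ) + 1) / 2) ^ 2 := by
      rw [← Real.exp_nat_mul]; push_cast; ring_nf
    rw [binThresh, this]
    field_simp
  rw [hT, div_lt_div_iff_of_pos_right hN', div_lt_div_iff_of_pos_right hN'] at hi
  rw [heavyWords, Finset.mem_filter]
  refine ⟨hiI, ?_⟩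
  rcases hi with hi | hi | hi
  · exact absurd hi (hfull _ (sum_row_le_degree C i Finset.univ))
  · exact absurd hi (hfull _ (sum_col_le_degree C i Finset.univ))
  · exact hi

lemma countMeasure_many_zeroed_le {M N : ℕ} (hN : 0 < N) (hMN : M ≤ N)
    {B : Matrix (Fin M) (Fin M) ℝ} {w kmin : ℝ} (hB : MargDominated M B w) (hw1 : w ≤ 1) (k : ℕ) :
    countMeasure M N B {C | Retained M N kmin C k ∧
      10 * w / (32 * binThresh N k ^ 2 * N) ≤ (zeroedSet M N w C C k).card} ≤
      ENNReal.ofReal (10 ^ 12 / N ^ 2) := by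
  have hN' : (0 : ℝ) < N := Nat.cast_pos.2 hN
  have hw := hB.w_pos
  set a : ℝ := Real.exp (((k : ℝ) + 1) / 2) with ha
  have ha0 : 0 < a := Real.exp_pos _
  have ha2 : Real.exp ((k : ℝ) + 1) = a ^ 2 := by
    rw [ha, ← Real.exp_nat_mul]; push_cast; ring_nf
  have ha3 : Real.exp (-(3 * ((k : ℝ) + 1)) / 2) = (a ^ 3)⁻¹ := by
    rw [ha, ← Real.exp_nat_mul, ← Real.exp_neg]; push_cast; ring_nf
  have hJ : ∀ n, binRange k n → (n : ℝ) < 2 * a ^ 2 / Real.exp 1 := by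
    intro n hn
    rw [← ha2, mul_div_assoc, ← Real.exp_sub, add_sub_cancel_right]
    exact hn.2
  refine (measure_mono ?_).trans (countMeasure_many_heavyWords_le hN hMN hB hw1 ha0 hJ)
  rintro C ⟨⟨-, h1⟩, h2⟩
  refine ⟨?_, ?_⟩
  · rw [binSet_eq_degreeBin hN, ha3] at h1
    refine le_trans (le_of_eq ?_) h1
    rw [div_eq_mul_inv]; ring
  · refine le_trans (le_trans (le_of_eq ?_) h2)
      (Nat.cast_le.2 (Finset.card_le_card (zeroedSet_subset_heavyWords hN hw C k)))
    rw [binThresh, ha2]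
    field_simp
    norm_num

/-- with probability `1 − o(1)` as `N → ∞`, simultaneously for every bin `k` with
`k ≥ k₀ = 4·log(c₀R/(ε√w_min)) + 16` and `|I_k| ≥ 20·e^{−3(k+1)/2}·N`, the regularization step
zeroes out fewer than `10·w_min/(32·ρ̄_k²·N)` rows and columns of the `k`-th diagonal block. -/
theorem stmt5 :
    ∃ c0 : ℝ, 0 < c0 ∧
      ∃ f : ℕ → ℝ, Tendsto f atTop (nhds 0) ∧
        ∀ (M R N : ℕ) (ε wmin : ℝ)
          (P : Matrix (Fin M) (Fin R) ℝ) (W : Matrix (Fin R) (Fin R) ℝ),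
          0 < ε → 0 < wmin → M ≤ N →
          (∀ i r, 0 ≤ P i r) → (∀ r, ∑ i, P i r = 1) →
          W.PosSemidef → (∀ s t, 0 ≤ W s t) → (∑ s, ∑ t, W s t) = 1 →
          (∀ s, wmin ≤ ∑ t, W s t) →
          ENNReal.ofReal (1 - f N) ≤
            countMeasure M N (P * W * Pᵀ)
              {C | ∀ k : ℕ, 1 ≤ k → (k : ℝ) ≤ Real.log N →
                Retained M N (k0def R c0 ε wmin) C k →
                ((zeroedSet M N wmin C C k).card : ℝ) <
                  10 * wmin / (32 * binThresh N k ^ 2 * N)} := by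
  refine ⟨1, one_pos, fun N => 10 ^ 12 / N, tendsto_const_div_atTop_nhds_zero_nat _, ?_⟩
  intro M R N ε wmin P W _ hw hMN hP hP1 hWpsd hW hW1 hWw
  set S : Set (Fin M × Fin M → ℕ) := {C | ∀ k : ℕ, 1 ≤ k → (k : ℝ) ≤ Real.log N →
    Retained M N (k0def R 1 ε wmin) C k → ((zeroedSet M N wmin C C k).card : ℝ) <
      10 * wmin / (32 * binThresh N k ^ 2 * N)} with hS
  rcases Nat.eq_zero_or_pos N with rfl | hN
  · have : S = Set.univ := by
      ext C
      simp only [hS, Set.mem_ofPred_eq, Set.mem_univ, iff_true, Nat.cast_zero, Real.log_zero]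
      intro k hk hk'
      have : (1 : ℝ) ≤ k := Nat.one_le_cast.2 hk
      linarith
    rw [this, measure_univ]
    simp
  have hN' : (0 : ℝ) < N := Nat.cast_pos.2 hN
  have hB : MargDominated M (P * W * Pᵀ) wmin :=
    margDominated_mul_mul_transpose hw hP hP1
      (fun s t => by simpa using (hWpsd.isHermitian.apply s t).symm) hW hWw
  have hw1 : wmin ≤ 1 := by
    obtain ⟨s, -, -⟩ := Finset.exists_ne_zero_of_sum_ne_zero (hW1.trans_ne one_ne_zero)
    exact (hWw s).trans (hW1 ▸ Finset.single_le_sum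
      (fun s _ => Finset.sum_nonneg fun t _ => hW s t) (Finset.mem_univ s))
  have hSc : Sᶜ ⊆ ⋃ k ∈ Finset.Icc 1 N, {C | Retained M N (k0def R 1 ε wmin) C k ∧
      10 * wmin / (32 * binThresh N k ^ 2 * N) ≤ (zeroedSet M N wmin C C k).card} := by
    intro C hC
    simp only [hS, Set.mem_compl_iff, Set.mem_ofPred_eq] at hC
    push Not at hC
    obtain ⟨k, hk, hk', hret, hle⟩ := hC
    have hkN : k ≤ N := by
      have h := hk'.trans (Real.log_le_self hN'.le)
      exact_mod_cast h
    simp only [Set.mem_iUnion]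
    exact ⟨k, Finset.mem_Icc.2 ⟨hk, hkN⟩, hret, hle⟩
  have hbad : countMeasure M N (P * W * Pᵀ) Sᶜ ≤ ENNReal.ofReal (10 ^ 12 / N) := by
    refine (measure_mono hSc).trans ((measure_biUnion_finset_le _ _).trans ?_)
    refine (Finset.sum_le_sum fun k _ =>
      countMeasure_many_zeroed_le hN hMN hB hw1 k).trans ?_
    rw [Finset.sum_const, Nat.card_Icc, Nat.add_sub_cancel, nsmul_eq_mul,
      ← ENNReal.ofReal_natCast, ← ENNReal.ofReal_mul (Nat.cast_nonneg _)]
    refine ENNReal.ofReal_le_ofReal (le_of_eq ?_)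
    field_simp
  have h1 : 1 ≤ countMeasure M N (P * W * Pᵀ) S + countMeasure M N (P * W * Pᵀ) Sᶜ := by
    rw [← measure_univ (μ := countMeasure M N (P * W * Pᵀ)), ← Set.union_compl_self S]
    exact measure_union_le _ _
  rw [ENNReal.ofReal_sub _ (by positivity), ENNReal.ofReal_one]
  exact tsub_le_iff_right.2 (h1.trans (by gcongr))
end
end

section
/- Let n be even and k ≥ 1. For a labeling σ ∈ {+,−}^n with exactly n/2 '+' labels and a sequence G ∈ {1,...,n}^k, define P_n(G|σ) = n^{−k}·Π_{i=1}^{k−1} ( (3/2)·𝟙{σ_{G_i} = σ_{G_{i+1}}} + (1/2)·𝟙{σ_{G_i} ≠ σ_{G_{i+1}}} ). Let σ, π be two such labelings with a = |σ⁺ ∩ π⁺| symbols labeled '+' under both, and set p = 2a/n. Then, for G drawn uniformly at random from {1,...,n}^k, E[P_n(G|σ)·P_n(G|π)] = r(p), where r(p) = (2^{−3k−1} n^{−2k} / √(64p(p−1)+25)) · [ √(64p(p−1)+25)·( (5+√(64p(p−1)+25))^k + (5−√(64p(p−1)+25))^k ) + 3·( (5+√(64p(p−1)+25))^k − (5−√(64p(p−1)+25))^k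 ) ]. -/
open Finset
open scoped Classical BigOperators

noncomputable section

/-- `P_n(G|σ) = n^{−k}·Π_{i=1}^{k−1} ((3/2)·𝟙{σ_{G_i} = σ_{G_{i+1}}} + (1/2)·𝟙{σ_{G_i} ≠ σ_{G_{i+1}}})`,
the conditional probability of observing the sequence `G` from the 2-state HMM with symmetric
switching probability 1/4, uniform initial state, and emissions uniform on `σ⁺` and on its
complement. -/
def Pcond (n k : ℕ) (σ : Fin n → Bool) (G : Fin k → Fin n) : ℝ :=
  ((n : ℝ) ^ k)⁻¹ *
    ∏ i : Fin k,
      if h : (i : ℕ) + 1 < k then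
        (if σ (G i) = σ (G ⟨(i : ℕ) + 1, h⟩) then (3 : ℝ) / 2 else 1 / 2)
      else 1

/-- The function `r(p)` from the cross-term computation. -/
def rfun (n k : ℕ) (p : ℝ) : ℝ :=
  (((2 : ℝ) ^ (3 * k + 1))⁻¹ * ((n : ℝ) ^ (2 * k))⁻¹ /
      Real.sqrt (64 * (p - 1) * p + 25)) *
    (Real.sqrt (64 * (p - 1) * p + 25) *
        ((5 + Real.sqrt (64 * (p - 1) * p + 25)) ^ k +
          (5 - Real.sqrt (64 * (p - 1) * p + 25)) ^ k) +
      3 * ((5 + Real.sqrt (64 * (p - 1) * p + 25)) ^ k -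
          (5 - Real.sqrt (64 * (p - 1) * p + 25)) ^ k))

/-- The `±1`-valued version of a labeling. -/
def labelSign (b : Bool) : ℝ := if b = true then 1 else -1

lemma labelSign_mul_self (b : Bool) : labelSign b * labelSign b = 1 := by
  cases b <;> simp [labelSign]

lemma switchWeight_eq (a b : Bool) :
    (if a = b then (3 : ℝ) / 2 else 1 / 2) = 1 + labelSign a * labelSign b / 2 := by
  cases a <;> cases b <;> norm_num [labelSign]

lemma Pcond_succ (n m : ℕ) (σ : Fin n → Bool) (G : Fin (m + 1) → Fin n) :
    Pcond n (m + 1) σ G = ((n : ℝ) ^ (m + 1))⁻¹ *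
      ∏ i : Fin m, (1 + labelSign (σ (G i.castSucc)) * labelSign (σ (G i.succ)) / 2) := by
  unfold Pcond
  rw [Fin.prod_univ_castSucc]
  simp only [switchWeight_eq]
  simp [Fin.succ]

/-- Sum of the path weights over all continuations of length `m` of a path standing at `x`. -/
def pathSum {α : Type*} [Fintype α] (w : α → α → ℝ) (m : ℕ) (x : α) : ℝ :=
  ∑ G : Fin m → α, ∏ i : Fin m,
    w ((Fin.cons x G : Fin (m + 1) → α) i.castSucc) ((Fin.cons x G : Fin (m + 1) → α) i.succ)

lemma pathSum_zero {α : Type*} [Fintype α] (w : α → α → ℝ) (x : α) : pathSum w 0 x = 1 := by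
  simp [pathSum]

lemma sum_fin_succ_pi {α : Type*} [Fintype α] (m : ℕ) (f : (Fin (m + 1) → α) → ℝ) :
    ∑ G, f G = ∑ x, ∑ G : Fin m → α, f (Fin.cons x G) := by
  rw [← (Fin.consEquiv fun _ : Fin (m + 1) => α).sum_comp, Fintype.sum_prod_type]
  rfl

lemma pathSum_succ {α : Type*} [Fintype α] (w : α → α → ℝ) (m : ℕ) (x : α) :
    pathSum w (m + 1) x = ∑ y, w x y * pathSum w m y := by
  unfold pathSum
  rw [sum_fin_succ_pi]
  refine Finset.sum_congr rfl fun y _ => ?_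
  rw [Finset.mul_sum]
  refine Finset.sum_congr rfl fun G _ => ?_
  rw [Fin.prod_univ_succ]
  simp

lemma sum_prod_eq_sum_pathSum {α : Type*} [Fintype α] (w : α → α → ℝ) (m : ℕ) :
    ∑ G : Fin (m + 1) → α, ∏ i : Fin m, w (G i.castSucc) (G i.succ) = ∑ x, pathSum w m x :=
  sum_fin_succ_pi m _

/-- Closed form of the path sums for the product of two balanced two-label weights whose
labels have correlation `c`. -/
lemma pathSum_eq {α : Type*} [Fintype α] (s t : α → ℝ) (hs : ∀ x, s x * s x = 1)
    (ht : ∀ x, t x * t x = 1) (hs0 : ∑ x, s x = 0) (ht0 : ∑ x, t x = 0) (N c S : ℝ)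
    (hN : (Fintype.card α : ℝ) = N) (hc : ∑ x, s x * t x = N * c) (hS : S ^ 2 = 16 * c ^ 2 + 9)
    (hS0 : S ≠ 0) (m : ℕ) (x : α) :
    pathSum (fun x y => (1 + s x * s y / 2) * (1 + t x * t y / 2)) m x =
      N ^ m * ((S * (((5 + S) / 8) ^ m + ((5 - S) / 8) ^ m) +
        3 * (((5 + S) / 8) ^ m - ((5 - S) / 8) ^ m)) / (2 * S) +
        c / S * (((5 + S) / 8) ^ m - ((5 - S) / 8) ^ m) * (s x * t x)) := by
  induction m generalizing x with
  | zero => rw [pathSum_zero]; field_simp; ring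
  | succ m ih =>
    rw [pathSum_succ]
    simp only [ih]
    generalize hL : ((5 + S) / 8) ^ m = L
    generalize hM : ((5 - S) / 8) ^ m = M
    generalize hA : (S * (L + M) + 3 * (L - M)) / (2 * S) = A
    generalize hB : c / S * (L - M) = B
    have expand : ∀ y, (1 + s x * s y / 2) * (1 + t x * t y / 2) *
        (N ^ m * (A + B * (s y * t y))) =
        N ^ m * ((A + B * (s x * t x) / 4) + (s x * A / 2 + t x * B / 2) * s y +
          (t x * A / 2 + s x * B / 2) * t y + (A * (s x * t x) / 4 + B) * (s y * t y)) := by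
      intro y
      linear_combination N ^ m * B * (t y * s x / 2 + s x * t x * t y * t y / 4) * hs y +
        N ^ m * B * (s y * t x / 2 + s x * t x / 4) * ht y
    simp only [expand]
    rw [← Finset.mul_sum]
    simp only [Finset.sum_add_distrib, ← Finset.mul_sum, hs0, ht0, hc, Finset.sum_const,
      Finset.card_univ, nsmul_eq_mul, hN]
    simp only [pow_succ, hL, hM]
    have h₁ : A + c * B = (S * (L * ((5 + S) / 8) + M * ((5 - S) / 8)) +
        3 * (L * ((5 + S) / 8) - M * ((5 - S) / 8))) / (2 * S) := by
      rw [← hA, ← hB]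
      field_simp
      linear_combination (M - L) * hS
    have h₂ : (c * A + B) / 4 = c / S * (L * ((5 + S) / 8) - M * ((5 - S) / 8)) := by
      rw [← hA, ← hB]
      field_simp
      ring
    rw [← h₁, ← h₂]
    ring

lemma sum_labelSign {α : Type*} [Fintype α] (σ : α → Bool) :
    ∑ x, labelSign (σ x) =
      2 * ((Finset.univ.filter fun j => σ j = true).card : ℝ) - Fintype.card α := by
  have h : ∀ x, labelSign (σ x) = 2 * (if σ x = true then 1 else 0) - 1 := by
    intro x; unfold labelSign; split_ifs <;> norm_num
  simp only [h, Finset.sum_sub_distrib, ← Finset.mul_sum, Finset.sum_boole]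
  simp

lemma sum_labelSign_mul {α : Type*} [Fintype α] [DecidableEq α] (σ π : α → Bool) :
    ∑ x, labelSign (σ x) * labelSign (π x) =
      4 * (((Finset.univ.filter fun j => σ j = true) ∩
        (Finset.univ.filter fun j => π j = true)).card : ℝ) -
      2 * ((Finset.univ.filter fun j => σ j = true).card : ℝ) -
      2 * ((Finset.univ.filter fun j => π j = true).card : ℝ) + Fintype.card α := by
  have h : ∀ x, labelSign (σ x) * labelSign (π x) = 4 * (if σ x = true ∧ π x = true then 1 else 0) -
      2 * (if σ x = true then 1 else 0) - 2 * (if π x = true then 1 else 0) + 1 := by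
    intro x
    unfold labelSign
    cases σ x <;> cases π x <;> norm_num
  rw [← Finset.filter_and]
  simp only [h, Finset.sum_sub_distrib, Finset.sum_add_distrib, ← Finset.mul_sum, Finset.sum_boole]
  simp

/-- for `n` even, `k ≥ 1`, and two labelings `σ, π` with exactly `n/2` '+' labels
each and `a = |σ⁺ ∩ π⁺|`, setting `p = 2a/n`, the expectation over a uniformly random sequence
`G ∈ {1,…,n}^k` of `P_n(G|σ)·P_n(G|π)` equals `r(p)`. -/
theorem stmt18 (n k : ℕ) (hn : Even n) (hk : 1 ≤ k) (σ π : Fin n → Bool)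
    (hσ : (Finset.univ.filter fun j => σ j = true).card = n / 2)
    (hπ : (Finset.univ.filter fun j => π j = true).card = n / 2) :
    ((n : ℝ) ^ k)⁻¹ * ∑ G : Fin k → Fin n, Pcond n k σ G * Pcond n k π G =
      rfun n k
        (2 * (((Finset.univ.filter fun j => σ j = true) ∩
            (Finset.univ.filter fun j => π j = true)).card : ℝ) / n) := by
  obtain ⟨m, rfl⟩ : ∃ m, k = m + 1 := ⟨k - 1, by omega⟩
  rcases Nat.eq_zero_or_pos n with rfl | hpos
  · simp [rfun]
  generalize ha : (((Finset.univ.filter fun j => σ j = true) ∩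
    (Finset.univ.filter fun j => π j = true)).card : ℝ) = a
  have hn0 : (n : ℝ) ≠ 0 := by positivity
  have half : ((n / 2 : ℕ) : ℝ) = n / 2 := Nat.cast_div hn.two_dvd (by norm_num)
  have hs0 : ∑ x, labelSign (σ x) = 0 := by
    rw [sum_labelSign, hσ, half, Fintype.card_fin]; ring
  have ht0 : ∑ x, labelSign (π x) = 0 := by
    rw [sum_labelSign, hπ, half, Fintype.card_fin]; ring
  obtain ⟨p, hp⟩ : ∃ p : ℝ, p = 2 * a / n := ⟨_, rfl⟩
  have hc : ∑ x, labelSign (σ x) * labelSign (π x) = n * (2 * p - 1) := by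
    rw [sum_labelSign_mul, ha, hσ, hπ, half, Fintype.card_fin, hp]
    field_simp
    ring
  rw [← hp]
  have disc_pos : 0 < 64 * (p - 1) * p + 25 := by nlinarith [sq_nonneg (2 * p - 1)]
  have hS0 : Real.sqrt (64 * (p - 1) * p + 25) ≠ 0 := (Real.sqrt_pos.mpr disc_pos).ne'
  have hS : Real.sqrt (64 * (p - 1) * p + 25) ^ 2 = 16 * (2 * p - 1) ^ 2 + 9 := by
    rw [Real.sq_sqrt disc_pos.le]; ring
  unfold rfun
  generalize Real.sqrt (64 * (p - 1) * p + 25) = S at hS0 hS ⊢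
  have key : ∑ G : Fin (m + 1) → Fin n, Pcond n (m + 1) σ G * Pcond n (m + 1) π G =
      ((n : ℝ) ^ (m + 1))⁻¹ * ((n : ℝ) ^ (m + 1))⁻¹ *
        ∑ x, pathSum (fun x y => (1 + labelSign (σ x) * labelSign (σ y) / 2) *
          (1 + labelSign (π x) * labelSign (π y) / 2)) m x := by
    rw [← sum_prod_eq_sum_pathSum, Finset.mul_sum]
    refine Finset.sum_congr rfl fun G _ => ?_
    rw [Pcond_succ, Pcond_succ, Finset.prod_mul_distrib]
    ring
  rw [key]
  simp only [pathSum_eq (fun x => labelSign (σ x)) (fun x => labelSign (π x))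
    (fun x => labelSign_mul_self _) (fun x => labelSign_mul_self _) hs0 ht0 n (2 * p - 1) S
    (by simp) hc hS hS0]
  rw [← Finset.mul_sum, Finset.sum_add_distrib, ← Finset.mul_sum, hc, Finset.sum_const,
    Finset.card_univ, Fintype.card_fin, nsmul_eq_mul]
  have h8 : (2 : ℝ) ^ (3 * (m + 1) + 1) = 16 * 8 ^ m := by
    rw [show 3 * (m + 1) + 1 = 4 + 3 * m by ring, pow_add, pow_mul]; norm_num
  rw [h8, div_pow, div_pow, pow_mul', pow_succ (5 + S), pow_succ (5 - S), pow_succ (n : ℝ)]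
  generalize (5 + S) ^ m = L
  generalize (5 - S) ^ m = M
  field_simp
  linear_combination 2 * (M - L) * hS
end
end
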